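/- arXiv:2603.28739 — 3 statements merged into one kernel-verified Lean document; each statement's English description precedes it below -/
import Mathlib

section
/- Let X ∈ R^{N×d} have i.i.d. rows drawn from N(0, Σ_x) with Σ_x ∈ R^{d×d} positive definite, d ≥ 2, and N > d + 3. Then there exists a universal constant C_4 > 0 such that E[||X†||² ||X||²] ≤ C_4 κ(Σ_x)·((√N + √d)/(√N − (d+3)/√N))², where X† is the Moore–Penrose pseudoinverse, ||·|| is the spectral norm, and κ(Σ_x) = σ_max(Σ_x)/σ_min(Σ_x) is the condition number of Σ_x. -/
open MeasureTheory ProbabilityTheory Matrix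

noncomputable section

namespace Stmt10

/-- Euclidean norm of a vector in `ℝ^n`. -/
def norm2 {n : ℕ} (v : Fin n → ℝ) : ℝ := Real.sqrt (∑ i, v i ^ 2)

/-- Spectral norm (`ℓ₂` operator norm) of a real matrix. -/
def spec {m n : ℕ} (A : Matrix (Fin m) (Fin n) ℝ) : ℝ :=
  sSup {c : ℝ | ∃ x : Fin n → ℝ, norm2 x = 1 ∧ c = norm2 (A *ᵥ x)}

/-- `s_min(A) = inf_{‖x‖=1} ‖Ax‖`. -/
def sMin {m n : ℕ} (A : Matrix (Fin m) (Fin n) ℝ) : ℝ :=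
  sInf {c : ℝ | ∃ x : Fin n → ℝ, norm2 x = 1 ∧ c = norm2 (A *ᵥ x)}

/-- `(XᵀX)⁻¹Xᵀ`, the Moore–Penrose pseudoinverse of a full-column-rank matrix. -/
def pinv {N d : ℕ} (X : Matrix (Fin N) (Fin d) ℝ) : Matrix (Fin d) (Fin N) ℝ :=
  (Xᵀ * X)⁻¹ * Xᵀ

/-- Law of a vector of `n` i.i.d. centered Gaussians with variance `v`. -/
def gaussianVec (n : ℕ) (v : ℝ) : Measure (Fin n → ℝ) :=
  Measure.pi fun _ => gaussianReal 0 (Real.toNNReal v)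

lemma norm2_eq {n : ℕ} (v : Fin n → ℝ) : norm2 v = ‖(WithLp.toLp 2 v : EuclideanSpace ℝ (Fin n))‖ := by
  rw [EuclideanSpace.norm_eq]; simp [norm2]

lemma norm2_sq {n : ℕ} (v : Fin n → ℝ) : norm2 v ^ 2 = v ⬝ᵥ v := by
  rw [norm2, Real.sq_sqrt (Finset.sum_nonneg fun i _ => sq_nonneg _)]
  simp [dotProduct, sq]

lemma norm2_nonneg {n : ℕ} (v : Fin n → ℝ) : 0 ≤ norm2 v := Real.sqrt_nonneg _

lemma norm2_smul {n : ℕ} (c : ℝ) (v : Fin n → ℝ) : norm2 (c • v) = |c| * norm2 v := by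
  rw [norm2_eq, norm2_eq, WithLp.toLp_smul, norm_smul, Real.norm_eq_abs]

lemma norm2_zero {n : ℕ} : norm2 (0 : Fin n → ℝ) = 0 := by simp [norm2]

lemma norm2_pos {n : ℕ} {v : Fin n → ℝ} (h : v ≠ 0) : 0 < norm2 v := by
  rw [norm2_eq, norm_pos_iff]; simpa using h

lemma dot_le {n : ℕ} (v w : Fin n → ℝ) : |v ⬝ᵥ w| ≤ norm2 v * norm2 w := by
  rw [norm2_eq, norm2_eq]
  have := abs_real_inner_le_norm (WithLp.toLp 2 v : EuclideanSpace ℝ (Fin n)) (WithLp.toLp 2 w)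
  simpa [EuclideanSpace.inner_eq_star_dotProduct, dotProduct_comm] using this

lemma continuous_norm2 {n : ℕ} : Continuous (norm2 : (Fin n → ℝ) → ℝ) := by
  unfold norm2; fun_prop

section op
open scoped Matrix.Norms.L2Operator

lemma norm2_mulVec_le {m n : ℕ} (A : Matrix (Fin m) (Fin n) ℝ) (x : Fin n → ℝ) :
    norm2 (A *ᵥ x) ≤ ‖A‖ * norm2 x := by
  rw [norm2_eq, norm2_eq]
  exact Matrix.l2_opNorm_mulVec A (WithLp.toLp 2 x)

lemma spec_attained {m n : ℕ} (hn : 0 < n) (A : Matrix (Fin m) (Fin n) ℝ) :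
    ∃ x : Fin n → ℝ, norm2 x = 1 ∧ norm2 (A *ᵥ x) = spec A ∧
      ∀ y : Fin n → ℝ, norm2 y = 1 → norm2 (A *ᵥ y) ≤ spec A := by
  have hc : IsCompact {x : Fin n → ℝ | norm2 x = 1} := by
    have : {x : Fin n → ℝ | norm2 x = 1} =
        (WithLp.ofLp : EuclideanSpace ℝ (Fin n) → _) '' Metric.sphere 0 1 := by
      ext x
      constructor
      · intro h
        exact ⟨WithLp.toLp 2 x, by simpa [← norm2_eq] using h, rfl⟩
      · rintro ⟨y, hy, rfl⟩
        simpa [norm2_eq] using hy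
    rw [this]
    exact (isCompact_sphere _ _).image (PiLp.continuous_ofLp 2 _)
  have hne : {x : Fin n → ℝ | norm2 x = 1}.Nonempty := by
    refine ⟨Pi.single ⟨0, hn⟩ 1, ?_⟩
    simp [norm2_eq]
  obtain ⟨x, hx, hmax⟩ := hc.exists_isMaxOn hne
    (f := fun x => norm2 (A *ᵥ x)) (continuous_norm2.comp (by fun_prop)).continuousOn
  have hb : spec A = norm2 (A *ᵥ x) := by
    apply IsGreatest.csSup_eq
    refine ⟨⟨x, hx, rfl⟩, ?_⟩
    rintro c ⟨y, hy, rfl⟩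
    exact hmax hy
  refine ⟨x, hx, hb.symm, fun y hy => hb ▸ hmax hy⟩

lemma spec_mulVec_le {m n : ℕ} (hn : 0 < n) (A : Matrix (Fin m) (Fin n) ℝ) (y : Fin n → ℝ) :
    norm2 (A *ᵥ y) ≤ spec A * norm2 y := by
  obtain ⟨x, hx, h1, h2⟩ := spec_attained hn A
  by_cases hy : y = 0
  · simp [hy, norm2_zero]
  have hp := norm2_pos hy
  have := h2 ((norm2 y)⁻¹ • y) (by
    rw [norm2_smul, abs_of_pos (inv_pos.2 hp), inv_mul_cancel₀ hp.ne'])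
  rw [mulVec_smul, norm2_smul, abs_of_pos (inv_pos.2 hp), inv_mul_le_iff₀ hp] at this
  linarith

lemma spec_eq {m n : ℕ} (hn : 0 < n) (A : Matrix (Fin m) (Fin n) ℝ) : spec A = ‖A‖ := by
  obtain ⟨x, hx, h1, h2⟩ := spec_attained hn A
  apply le_antisymm
  · rw [← h1]; simpa [hx] using norm2_mulVec_le A x
  · rw [Matrix.l2_opNorm_def]
    refine ContinuousLinearMap.opNorm_le_bound _ (h1 ▸ norm2_nonneg _) fun y => ?_
    have := spec_mulVec_le hn A y.ofLp
    rw [norm2_eq, norm2_eq] at this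
    exact this

lemma spec_nonneg {m n : ℕ} (hn : 0 < n) (A : Matrix (Fin m) (Fin n) ℝ) : 0 ≤ spec A := by
  rw [spec_eq hn]; positivity

lemma spec_transpose {m n : ℕ} (hm : 0 < m) (hn : 0 < n) (A : Matrix (Fin m) (Fin n) ℝ) :
    spec Aᵀ = spec A := by
  rw [spec_eq hn, spec_eq hm, ← Matrix.l2_opNorm_conjTranspose A, conjTranspose_eq_transpose_of_trivial]

lemma spec_mul_le {m n l : ℕ} (hn : 0 < n) (hl : 0 < l) (A : Matrix (Fin m) (Fin n) ℝ)
    (B : Matrix (Fin n) (Fin l) ℝ) : spec (A * B) ≤ spec A * spec B := by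
  rw [spec_eq hl, spec_eq hn, spec_eq hl]; exact Matrix.l2_opNorm_mul A B

lemma spec_mul_transpose {m n : ℕ} (hm : 0 < m) (hn : 0 < n) (A : Matrix (Fin m) (Fin n) ℝ) :
    spec (A * Aᵀ) = spec A ^ 2 := by
  have := Matrix.l2_opNorm_conjTranspose_mul_self (Aᵀ)
  rw [conjTranspose_eq_transpose_of_trivial, transpose_transpose] at this
  rw [spec_eq hm, this, ← spec_eq hm, spec_transpose hm hn, sq]

end op

/-- deterministic reduction -/
lemma det_reduction {N d : ℕ} (hN : 0 < N) (hd : 0 < d) (S A : Matrix (Fin d) (Fin d) ℝ)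
    (hS : S.PosDef) (hA : A * Aᵀ = S) (G : Matrix (Fin N) (Fin d) ℝ) :
    spec (pinv (G * Aᵀ)) ^ 2 * spec (G * Aᵀ) ^ 2 ≤
      (spec S / sMin S) * (spec (pinv G) ^ 2 * spec G ^ 2) ∧ 0 ≤ spec S / sMin S := by
  have hSu : IsUnit S.det := (Matrix.isUnit_iff_isUnit_det _).1 hS.isUnit
  have hAu : IsUnit A.det := by
    rw [← hA, det_mul, det_transpose] at hSu
    exact isUnit_of_mul_isUnit_left hSu
  have hp : pinv (G * Aᵀ) = (A⁻¹)ᵀ * pinv G := by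
    unfold pinv
    rw [transpose_mul, transpose_transpose]
    rw [show A * Gᵀ * (G * Aᵀ) = A * ((Gᵀ * G) * Aᵀ) by simp only [Matrix.mul_assoc]]
    rw [Matrix.mul_inv_rev, Matrix.mul_inv_rev, transpose_nonsing_inv]
    simp only [Matrix.mul_assoc]
    rw [← Matrix.mul_assoc A⁻¹ A, Matrix.nonsing_inv_mul _ hAu, Matrix.one_mul]
  have hSinv : (A⁻¹)ᵀ * ((A⁻¹)ᵀ)ᵀ = S⁻¹ := by
    rw [← hA, Matrix.mul_inv_rev, transpose_transpose, transpose_nonsing_inv]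
  have h1 : spec (A⁻¹)ᵀ ^ 2 = spec S⁻¹ := by rw [← spec_mul_transpose hd hd, hSinv]
  have h2 : spec Aᵀ ^ 2 = spec S := by rw [spec_transpose hd hd, ← spec_mul_transpose hd hd, hA]
  have hSi : 0 < spec S⁻¹ := by
    obtain ⟨x, hx, -, h⟩ := spec_attained hd S⁻¹
    have := spec_mulVec_le hd S⁻¹ (S *ᵥ x)
    rw [mulVec_mulVec, Matrix.nonsing_inv_mul _ hSu, one_mulVec, hx] at this
    rcases (spec_nonneg hd S⁻¹).eq_or_lt with h | h
    · rw [← h] at this; simp at this; linarith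
    · exact h
  have hbdd : BddBelow {c : ℝ | ∃ x : Fin d → ℝ, norm2 x = 1 ∧ c = norm2 (S *ᵥ x)} :=
    ⟨0, by rintro c ⟨x, hx, rfl⟩; exact norm2_nonneg _⟩
  have hs0 : (spec S⁻¹)⁻¹ ≤ sMin S := by
    apply le_csInf
    · obtain ⟨x, hx, -, h⟩ := spec_attained hd S⁻¹
      exact ⟨_, x, hx, rfl⟩
    · rintro c ⟨x, hx, rfl⟩
      have := spec_mulVec_le hd S⁻¹ (S *ᵥ x)
      rw [mulVec_mulVec, Matrix.nonsing_inv_mul _ hSu, one_mulVec, hx] at this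
      rw [inv_le_iff_one_le_mul₀ hSi]; linarith
  have hspos : 0 < sMin S := lt_of_lt_of_le (inv_pos.2 hSi) hs0
  have hs1 : spec S⁻¹ ≤ (sMin S)⁻¹ := by
    obtain ⟨x, hx, h, -⟩ := spec_attained hd S⁻¹
    set y := S⁻¹ *ᵥ x with hy
    have hyp : 0 < norm2 y := by rw [h]; exact hSi
    have hm : sMin S ≤ norm2 (S *ᵥ ((norm2 y)⁻¹ • y)) := by
      apply csInf_le hbdd
      exact ⟨_, by rw [norm2_smul, abs_of_pos (inv_pos.2 hyp), inv_mul_cancel₀ hyp.ne'], rfl⟩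
    rw [mulVec_smul, norm2_smul, hy, mulVec_mulVec, Matrix.mul_nonsing_inv _ hSu, one_mulVec, hx,
      ← hy, abs_of_pos (inv_pos.2 hyp), h, mul_one] at hm
    rwa [le_inv_comm₀ hSi hspos]
  have hS0 := spec_nonneg hd S
  refine ⟨?_, by positivity⟩
  have e1 : spec (pinv (G * Aᵀ)) ^ 2 ≤ (sMin S)⁻¹ * spec (pinv G) ^ 2 := by
    rw [hp]
    calc _ ≤ (spec (A⁻¹)ᵀ * spec (pinv G)) ^ 2 :=
          pow_le_pow_left₀ (spec_nonneg hN _) (spec_mul_le hd hN _ _) 2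
      _ = spec S⁻¹ * spec (pinv G) ^ 2 := by rw [mul_pow, h1]
      _ ≤ _ := by gcongr
  have e2 : spec (G * Aᵀ) ^ 2 ≤ spec S * spec G ^ 2 := by
    calc _ ≤ (spec G * spec Aᵀ) ^ 2 :=
          pow_le_pow_left₀ (spec_nonneg hd _) (spec_mul_le hd hd _ _) 2
      _ = spec S * spec G ^ 2 := by rw [mul_pow, h2, mul_comm]
  calc _ ≤ ((sMin S)⁻¹ * spec (pinv G) ^ 2) * (spec S * spec G ^ 2) := by gcongr
    _ = _ := by field_simp


open scoped ENNReal NNReal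

lemma gaussianVec_one (n : ℕ) : gaussianVec n 1 = Measure.pi fun _ => gaussianReal 0 1 := by
  simp [gaussianVec]

instance (n : ℕ) : IsProbabilityMeasure (gaussianVec n 1) := by
  rw [gaussianVec_one]; infer_instance

/-- matrix of an orthonormal basis -/
def bmat {n : ℕ} (b : OrthonormalBasis (Fin n) ℝ (EuclideanSpace ℝ (Fin n))) :
    Matrix (Fin n) (Fin n) ℝ := Matrix.of fun i j => b i j

lemma bmat_mulVec {n : ℕ} (b : OrthonormalBasis (Fin n) ℝ (EuclideanSpace ℝ (Fin n)))
    (x : Fin n → ℝ) : bmat b *ᵥ x = (b.repr (WithLp.toLp 2 x)).ofLp := by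
  ext i
  rw [b.repr_apply_apply]
  simp [bmat, mulVec, EuclideanSpace.inner_eq_star_dotProduct, dotProduct_comm]

lemma bmat_mul {n : ℕ} (b : OrthonormalBasis (Fin n) ℝ (EuclideanSpace ℝ (Fin n))) :
    bmat b * (bmat b)ᵀ = 1 := by
  ext i j
  have := orthonormal_iff_ite.1 b.orthonormal i j
  rw [Matrix.one_apply, ← this]
  simp [bmat, Matrix.mul_apply, EuclideanSpace.inner_eq_star_dotProduct, dotProduct, mul_comm]

lemma bmat_mul' {n : ℕ} (b : OrthonormalBasis (Fin n) ℝ (EuclideanSpace ℝ (Fin n))) :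
    (bmat b)ᵀ * bmat b = 1 := mul_eq_one_comm.1 (bmat_mul b)

lemma bmat_dot {n : ℕ} (b : OrthonormalBasis (Fin n) ℝ (EuclideanSpace ℝ (Fin n)))
    (x : Fin n → ℝ) : (bmat b *ᵥ x) ⬝ᵥ (bmat b *ᵥ x) = x ⬝ᵥ x := by
  rw [dotProduct_mulVec, vecMul_mulVec, bmat_mul', vecMul_one]

lemma bmat_preserving {n : ℕ} (b : OrthonormalBasis (Fin n) ℝ (EuclideanSpace ℝ (Fin n))) :
    MeasurePreserving (fun x => bmat b *ᵥ x) (gaussianVec n 1) (gaussianVec n 1) := by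
  rw [gaussianVec_one]
  have h1 : MeasurePreserving (WithLp.toLp 2 : (Fin n → ℝ) → EuclideanSpace ℝ (Fin n))
      (Measure.pi fun _ => gaussianReal 0 1) (stdGaussian _) :=
    ⟨by fun_prop, map_pi_eq_stdGaussian⟩
  have h2 : MeasurePreserving b.repr (stdGaussian (EuclideanSpace ℝ (Fin n))) (stdGaussian _) :=
    ⟨by fun_prop, stdGaussian_map b.repr⟩
  have h3 : MeasurePreserving (WithLp.ofLp : EuclideanSpace ℝ (Fin n) → (Fin n → ℝ)) 
      (stdGaussian _) (Measure.pi fun _ => gaussianReal 0 1) := by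
    refine ⟨by fun_prop, ?_⟩
    rw [← map_pi_eq_stdGaussian, Measure.map_map (by fun_prop) (by fun_prop)]
    exact Measure.map_id
  convert h3.comp (h2.comp h1) using 1
  ext1 x
  exact bmat_mulVec b x

lemma exists_basis {n k : ℕ} (v : Fin n → Fin n → ℝ)
    (hv : ∀ i j : Fin n, (i : ℕ) < k → (j : ℕ) < k → v i ⬝ᵥ v j = if i = j then 1 else 0) :
    ∃ b : OrthonormalBasis (Fin n) ℝ (EuclideanSpace ℝ (Fin n)),
      ∀ i : Fin n, (i : ℕ) < k → bmat b i = v i := by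
  obtain ⟨b, hb⟩ := Orthonormal.exists_orthonormalBasis_extension_of_card_eq (𝕜 := ℝ)
    (E := EuclideanSpace ℝ (Fin n)) (ι := Fin n) (by simp)
    (v := fun i => WithLp.toLp 2 (v i)) (s := {i | (i : ℕ) < k}) (by
      rw [orthonormal_iff_ite]
      rintro ⟨i, hi⟩ ⟨j, hj⟩
      have := hv i j hi hj
      simp [Set.domRestrict, EuclideanSpace.inner_eq_star_dotProduct, dotProduct_comm, this])
  refine ⟨b, fun i hi => ?_⟩
  have := hb i hi
  ext j
  simp [bmat, this]

lemma exists_basis_unit {n : ℕ} (u : Fin (n+1) → ℝ) (hu : u ⬝ᵥ u = 1) :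
    ∃ b : OrthonormalBasis (Fin (n+1)) ℝ (EuclideanSpace ℝ (Fin (n+1))), bmat b 0 = u := by
  obtain ⟨b, hb⟩ := exists_basis (k := 1) (fun _ => u) (by
    intro i j hi hj
    have : i = j := by ext; omega
    simp [this, hu])
  exact ⟨b, hb 0 (by simp)⟩

lemma lintegral_pi_prod {ι α : Type*} [Fintype ι] [MeasurableSpace α] (μ : ι → Measure α)
    [∀ i, IsProbabilityMeasure (μ i)]
    (s : Finset ι) (f : α → ℝ≥0∞) (hf : Measurable f) :
    ∫⁻ x, ∏ i ∈ s, f (x i) ∂(Measure.pi μ) = ∏ i ∈ s, ∫⁻ x, f x ∂(μ i) := by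
  rw [lintegral_prod_eq_prod_lintegral_of_indepFun (μ := Measure.pi μ) s
    (fun i (x : ι → α) => f (x i))
    (iIndepFun_pi (X := fun _ => f) fun i => hf.aemeasurable) (fun i => by fun_prop)]
  refine Finset.prod_congr rfl fun i _ => ?_
  exact (measurePreserving_eval μ i).lintegral_comp hf

lemma lintegral_gaussian (f : ℝ → ℝ≥0∞) (hf : Measurable f) :
    ∫⁻ x, f x ∂(gaussianReal 0 1) = ∫⁻ x, gaussianPDF 0 1 x * f x := by
  rw [gaussianReal_of_var_ne_zero 0 one_ne_zero,
    lintegral_withDensity_eq_lintegral_mul _ (measurable_gaussianPDF 0 1) hf]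
  rfl

lemma pdf_eq (x : ℝ) : gaussianPDFReal 0 1 x = (√(2 * Real.pi))⁻¹ * Real.exp (-x^2/2) := by
  simp [gaussianPDFReal]

def M1 : ℝ≥0∞ := ∫⁻ x, ENNReal.ofReal |x| ^ (-(4/5) : ℝ) ∂(gaussianReal 0 1)
def M2 : ℝ≥0∞ := ∫⁻ x, ENNReal.ofReal (Real.exp (x ^ 2 / 4)) ∂(gaussianReal 0 1)

lemma integrable_abs {f : ℝ → ℝ} (hf0 : IntegrableOn f (Set.Ioi 0)) :
    Integrable (fun x => f |x|) := by
  have hf : IntegrableOn (fun x => f |x|) (Set.Ioi 0) :=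
    hf0.congr_fun (fun x hx => by rw [abs_of_pos hx]) measurableSet_Ioi
  have int_Iic : IntegrableOn (fun x ↦ f |x|) (Set.Iic 0) := by
    rw [← Measure.map_neg_eq_self (volume : Measure ℝ)]
    let m : MeasurableEmbedding fun x : ℝ => -x := (Homeomorph.neg ℝ).measurableEmbedding
    rw [m.integrableOn_map_iff]
    simp_rw [Function.comp_def, abs_neg, Set.neg_preimage, Set.neg_Iic, neg_zero]
    exact Iff.mpr integrableOn_Ici_iff_integrableOn_Ioi hf
  rw [← integrableOn_univ, ← Set.Iic_union_Ioi (a := (0 : ℝ))]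
  exact int_Iic.union hf

lemma M1_lt : M1 < ∞ := by
  unfold M1
  rw [lintegral_gaussian _ (by fun_prop)]
  have h : Integrable (fun x : ℝ => (fun y : ℝ => y ^ (-(4/5) : ℝ) * Real.exp (-(1/2) * y^2)) |x|) := by
    refine integrable_abs (f := fun y : ℝ => y ^ (-(4/5) : ℝ) * Real.exp (-(1/2) * y^2)) ?_
    exact integrableOn_rpow_mul_exp_neg_mul_sq (by norm_num) (by norm_num)
  have h2 := (h.const_mul (√(2 * Real.pi))⁻¹).lintegral_lt_top
  refine lt_of_le_of_lt (le_of_eq (lintegral_congr_ae ?_)) h2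
  have : ∀ᵐ x : ℝ, x ≠ 0 := by simp [ae_iff]
  filter_upwards [this] with x hx
  rw [ENNReal.ofReal_rpow_of_pos (abs_pos.2 hx), gaussianPDF, pdf_eq,
    ← ENNReal.ofReal_mul (by positivity)]
  congr 1
  rw [sq_abs]
  ring_nf

lemma M2_lt : M2 < ∞ := by
  unfold M2
  rw [lintegral_gaussian _ (by fun_prop)]
  have h : Integrable (fun x : ℝ => Real.exp (-(1/4) * x^2)) := integrable_exp_neg_mul_sq (by norm_num)
  have h2 := (h.const_mul (√(2 * Real.pi))⁻¹).lintegral_lt_top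
  refine lt_of_le_of_lt (le_of_eq (lintegral_congr fun x => ?_)) h2
  rw [gaussianPDF, pdf_eq, ← ENNReal.ofReal_mul (by positivity), mul_assoc, ← Real.exp_add]
  congr 3
  ring

lemma M1_pos : 0 < M1 := by
  unfold M1
  rw [lintegral_pos_iff_support (by fun_prop)]
  rw [show Function.support (fun x : ℝ => ENNReal.ofReal |x| ^ (-(4/5) : ℝ)) = Set.univ by
    ext x; simp [ENNReal.rpow_eq_zero_iff]; norm_num]
  simp

lemma one_le_M2 : 1 ≤ M2 := by
  unfold M2
  calc (1 : ℝ≥0∞) = ∫⁻ x, 1 ∂(gaussianReal 0 1) := by simp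
    _ ≤ _ := lintegral_mono fun x => by
      rw [ENNReal.one_le_ofReal]; exact Real.one_le_exp (by positivity)

def c0 : ℝ := (√(2 * Real.pi))⁻¹ * Real.exp (-1) / 2

lemma c0_pos : 0 < c0 := by unfold c0; positivity

lemma lintegral_sq_gaussian : ∫⁻ x, ENNReal.ofReal (x^2) ∂(gaussianReal 0 1) = 1 := by
  have h := ofReal_variance (memLp_id_gaussianReal (μ := 0) (v := 1) 2)
  rw [variance_id_gaussianReal] at h
  simp only [evariance, id, integral_id_gaussianReal, sub_zero] at h
  rw [NNReal.coe_one, ENNReal.ofReal_one] at h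
  rw [h]
  refine lintegral_congr fun x => ?_
  rw [Real.enorm_eq_ofReal_abs, ← ENNReal.ofReal_pow (abs_nonneg _), sq_abs]

lemma gaussian_interval (p : ℝ) (hp : 0 ≤ p) :
    ENNReal.ofReal ((√(2 * Real.pi))⁻¹ * Real.exp (-p-1)) ≤
      gaussianReal 0 1 (Set.Icc (√p) (√p + 1)) := by
  rw [gaussianReal_apply 0 one_ne_zero]
  calc _ = ∫⁻ x in Set.Icc (√p) (√p + 1), ENNReal.ofReal ((√(2 * Real.pi))⁻¹ * Real.exp (-p-1)) := by
        simp
    _ ≤ _ := by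
        refine setLIntegral_mono (measurable_gaussianPDF 0 1) fun x hx => ?_
        rw [gaussianPDF, pdf_eq]
        refine ENNReal.ofReal_le_ofReal ?_
        gcongr
        have h1 := Real.sq_sqrt hp
        have h0 := Real.sqrt_nonneg p
        nlinarith [hx.1, hx.2, sq_nonneg (√p - 1)]

lemma gaussian_ball (n : ℕ) :
    (1/2 : ℝ≥0∞) ≤ gaussianVec n 1 {y | y ⬝ᵥ y ≤ 2 * n + 1} := by
  have hm : Measurable fun y : Fin n → ℝ => y ⬝ᵥ y := by unfold dotProduct; fun_prop
  have hint : ∫⁻ y, ENNReal.ofReal (y ⬝ᵥ y) ∂(gaussianVec n 1) = n := by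
    have : ∀ y : Fin n → ℝ, ENNReal.ofReal (y ⬝ᵥ y) = ∑ i, ENNReal.ofReal (y i ^ 2) := by
      intro y
      rw [dotProduct, ENNReal.ofReal_sum_of_nonneg fun i _ => mul_self_nonneg _]
      simp [sq]
    simp_rw [this]
    rw [lintegral_finsetSum _ (fun i _ => by fun_prop), gaussianVec_one]
    have : ∀ i : Fin n, ∫⁻ y : Fin n → ℝ, ENNReal.ofReal (y i ^ 2)
        ∂(Measure.pi fun _ => gaussianReal 0 1) = 1 := fun i => by
      rw [← lintegral_sq_gaussian]
      exact (measurePreserving_eval (fun _ : Fin n => gaussianReal 0 1) i).lintegral_comp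
        (f := fun x => ENNReal.ofReal (x^2)) (by fun_prop)
    simp [this]
  have hmk := mul_meas_ge_le_lintegral (μ := gaussianVec n 1)
    (f := fun y => ENNReal.ofReal (y ⬝ᵥ y)) (by fun_prop) (ENNReal.ofReal (2 * n + 1))
  rw [hint] at hmk
  set s := {y : Fin n → ℝ | ENNReal.ofReal (2 * n + 1) ≤ ENNReal.ofReal (y ⬝ᵥ y)} with hs
  have hsm : MeasurableSet s := measurableSet_le measurable_const (by fun_prop)
  have hsle : gaussianVec n 1 s ≤ 1/2 := by
    by_contra! hcon
    have hn : (n : ℝ≥0∞) < ENNReal.ofReal (2 * n + 1) * (1/2) := by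
      rw [show (n : ℝ≥0∞) = ENNReal.ofReal n by simp, show (1/2 : ℝ≥0∞) = ENNReal.ofReal (1/2) by
        rw [ENNReal.ofReal_div_of_pos (by norm_num)]; simp, ← ENNReal.ofReal_mul (by positivity),
        ENNReal.ofReal_lt_ofReal_iff (by positivity)]
      linarith
    have : ENNReal.ofReal (2 * n + 1) * (1/2) ≤ ENNReal.ofReal (2 * n + 1) * gaussianVec n 1 s := by
      gcongr
    exact absurd hmk (not_le.2 (lt_of_lt_of_le hn this))
  have hc : sᶜ ⊆ {y | y ⬝ᵥ y ≤ 2 * n + 1} := by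
    intro y hy
    simp only [hs, Set.mem_compl_iff, Set.mem_ofPred_eq, not_le] at hy
    exact ((ENNReal.ofReal_lt_ofReal_iff (by positivity)).1 hy).le
  calc (1/2 : ℝ≥0∞) ≤ 1 - gaussianVec n 1 s := by
        apply ENNReal.le_sub_of_add_le_left (ne_top_of_le_ne_top (by simp) hsle)
        calc _ ≤ (1/2 : ℝ≥0∞) + 1/2 := by gcongr
          _ = 1 := ENNReal.add_halves 1
    _ = gaussianVec n 1 sᶜ := (prob_compl_eq_one_sub hsm).symm
    _ ≤ _ := measure_mono hc

lemma small_ball {N d : ℕ} (hd : 0 < d) (hdN : d ≤ N) (p : ℝ) (hp : 0 ≤ p) (hpN : p ≤ N)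
    (u : Fin d → ℝ) (hu : norm2 u = 1) :
    ENNReal.ofReal (c0 * Real.exp (-p)) ≤
      gaussianVec d 1 {z | p ≤ (u ⬝ᵥ z) ^ 2 ∧ z ⬝ᵥ z ≤ 5 * N} := by
  obtain ⟨n, rfl⟩ : ∃ n, d = n + 1 := ⟨d - 1, by omega⟩
  have hu' : u ⬝ᵥ u = 1 := by rw [← norm2_sq, hu]; norm_num
  obtain ⟨b, hb⟩ := exists_basis_unit u hu'
  have hset : {z | p ≤ (u ⬝ᵥ z) ^ 2 ∧ z ⬝ᵥ z ≤ 5 * N} =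
      (fun x => bmat b *ᵥ x) ⁻¹' {y : Fin (n+1) → ℝ | p ≤ (y 0) ^ 2 ∧ y ⬝ᵥ y ≤ 5 * N} := by
    ext z
    simp only [Set.mem_ofPred_eq, Set.mem_preimage, bmat_dot]
    simp [mulVec, hb]
  rw [hset, (bmat_preserving b).measure_preimage]
  swap
  · have hm : Measurable fun y : Fin (n+1) → ℝ => y ⬝ᵥ y := by unfold dotProduct; fun_prop
    have h1 : MeasurableSet {y : Fin (n+1) → ℝ | p ≤ (y 0) ^ 2} :=
      measurableSet_le measurable_const (by fun_prop)
    have h2 : MeasurableSet {y : Fin (n+1) → ℝ | y ⬝ᵥ y ≤ 5 * N} :=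
      measurableSet_le hm measurable_const
    exact (h1.inter h2).nullMeasurableSet
  have hmp := measurePreserving_piFinSuccAbove (fun _ : Fin (n+1) => gaussianReal 0 1) 0
  rw [gaussianVec_one]
  have hsub : (MeasurableEquiv.piFinSuccAbove (fun _ : Fin (n+1) => ℝ) 0) ⁻¹'
      (Set.Icc (√p) (√p + 1) ×ˢ {y : Fin n → ℝ | y ⬝ᵥ y ≤ 2 * n + 1}) ⊆
      {y : Fin (n+1) → ℝ | p ≤ (y 0) ^ 2 ∧ y ⬝ᵥ y ≤ 5 * N} := by
    rintro y ⟨⟨h1, h2⟩, h3⟩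
    have e0 : (MeasurableEquiv.piFinSuccAbove (fun _ : Fin (n+1) => ℝ) 0 y).1 = y 0 := rfl
    have e1 : (MeasurableEquiv.piFinSuccAbove (fun _ : Fin (n+1) => ℝ) 0 y).2 = 
      fun i => y i.succ := rfl
    rw [e0] at h1 h2
    simp only [e1, Set.mem_ofPred_eq] at h3
    have h5 := Real.sq_sqrt hp
    have h6 := Real.sqrt_nonneg p
    refine ⟨by nlinarith, ?_⟩
    have : y ⬝ᵥ y = y 0 ^ 2 + (fun i : Fin n => y i.succ) ⬝ᵥ (fun i => y i.succ) := by
      simp [dotProduct, Fin.sum_univ_succ, sq]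
    rw [this]
    have h7 : (y 0)^2 ≤ 2 * p + 2 := by nlinarith [sq_nonneg (√p - 1)]
    have h8 : (n : ℝ) + 1 ≤ N := by exact_mod_cast hdN
    have h9 : (0 : ℝ) ≤ n := by positivity
    linarith
  refine le_trans ?_ (measure_mono hsub)
  rw [hmp.measure_preimage_equiv, Measure.prod_prod]
  calc _ = ENNReal.ofReal ((√(2 * Real.pi))⁻¹ * Real.exp (-p-1)) * (1/2) := by
        rw [show (1/2 : ℝ≥0∞) = ENNReal.ofReal (1/2) by
          rw [ENNReal.ofReal_div_of_pos (by norm_num)]; simp, ← ENNReal.ofReal_mul (by positivity)]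
        congr 1
        rw [c0, show -p - 1 = -p + -1 by ring, Real.exp_add]; ring
    _ ≤ _ := by
        gcongr
        · exact gaussian_interval p hp
        · have := gaussian_ball n
          rwa [gaussianVec_one] at this

/-- smoothing lemma -/
lemma smoothing {N m d : ℕ} (hm : 0 < m) (hd : 0 < d) (hdN : d ≤ N) (p : ℝ) (hp : 0 ≤ p) (hpN : p ≤ N)
    (B : Matrix (Fin m) (Fin d) ℝ) (φ : ℝ → ℝ≥0∞) (hφ : Monotone φ) :
    ENNReal.ofReal (c0 * Real.exp (-p)) * φ (p * spec B ^ 2) ≤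
      ∫⁻ z in {z | z ⬝ᵥ z ≤ 5 * N}, φ ((B *ᵥ z) ⬝ᵥ (B *ᵥ z)) ∂(gaussianVec d 1) := by
  obtain ⟨w, hw, hws, -⟩ := spec_attained hm Bᵀ
  rw [spec_transpose hm hd] at hws
  obtain ⟨u, hu, hBu⟩ : ∃ u : Fin d → ℝ, norm2 u = 1 ∧ Bᵀ *ᵥ w = spec B • u := by
    by_cases h0 : spec B = 0
    · refine ⟨Pi.single ⟨0, hd⟩ 1, by simp [norm2_eq], ?_⟩
      rw [h0, zero_smul]
      by_contra hne
      have := norm2_pos hne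
      rw [hws, h0] at this
      exact lt_irrefl _ this
    · refine ⟨(spec B)⁻¹ • (Bᵀ *ᵥ w), ?_, by rw [smul_smul, mul_inv_cancel₀ h0, one_smul]⟩
      rw [norm2_smul, hws, abs_of_nonneg (inv_nonneg.2 (spec_nonneg hd B)), inv_mul_cancel₀ h0]
  set T := {z : Fin d → ℝ | p ≤ (u ⬝ᵥ z) ^ 2 ∧ z ⬝ᵥ z ≤ 5 * N} with hT
  have hmd : Measurable fun y : Fin d → ℝ => y ⬝ᵥ y := by unfold dotProduct; fun_prop
  have hmu : Measurable fun y : Fin d → ℝ => u ⬝ᵥ y := by unfold dotProduct; fun_prop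
  have h1 : MeasurableSet {y : Fin d → ℝ | p ≤ (u ⬝ᵥ y) ^ 2} :=
    measurableSet_le measurable_const (by fun_prop)
  have h2 : MeasurableSet {y : Fin d → ℝ | y ⬝ᵥ y ≤ 5 * N} :=
    measurableSet_le hmd measurable_const
  have hTm : MeasurableSet T := h1.inter h2
  have hT2 : T ⊆ {z | z ⬝ᵥ z ≤ 5 * N} := fun z hz => hz.2
  calc _ ≤ gaussianVec d 1 T * φ (p * spec B ^ 2) := by
        gcongr; exact small_ball hd hdN p hp hpN u hu
    _ = ∫⁻ z in T, φ (p * spec B ^ 2) ∂(gaussianVec d 1) := by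
        rw [setLIntegral_const, mul_comm]
    _ ≤ ∫⁻ z in T, φ ((B *ᵥ z) ⬝ᵥ (B *ᵥ z)) ∂(gaussianVec d 1) := by
        refine setLIntegral_mono' hTm fun z hz => hφ ?_
        have h1 := dot_le w (B *ᵥ z)
        rw [dotProduct_mulVec, ← mulVec_transpose, hBu, smul_dotProduct, hw, one_mul] at h1
        rw [← norm2_sq]
        calc _ ≤ (u ⬝ᵥ z) ^ 2 * spec B ^ 2 := by gcongr; exact hz.1
          _ = |spec B • (u ⬝ᵥ z)| ^ 2 := by rw [sq_abs, smul_eq_mul]; ring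
          _ ≤ _ := by gcongr
    _ ≤ _ := lintegral_mono_set hT2

lemma pinv_mul_transpose {N d : ℕ} (A : Matrix (Fin d) (Fin d) ℝ) (hAu : IsUnit A.det)
    (G : Matrix (Fin N) (Fin d) ℝ) : pinv (G * Aᵀ) = (A⁻¹)ᵀ * pinv G := by
  unfold pinv
  rw [transpose_mul, transpose_transpose]
  rw [show A * Gᵀ * (G * Aᵀ) = A * ((Gᵀ * G) * Aᵀ) by simp only [Matrix.mul_assoc]]
  rw [Matrix.mul_inv_rev, Matrix.mul_inv_rev, transpose_nonsing_inv]
  simp only [Matrix.mul_assoc]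
  rw [← Matrix.mul_assoc A⁻¹ A, Matrix.nonsing_inv_mul _ hAu, Matrix.one_mul]

lemma rot_preserving {N d : ℕ} (b : OrthonormalBasis (Fin d) ℝ (EuclideanSpace ℝ (Fin d))) :
    MeasurePreserving (fun (g : Fin N → Fin d → ℝ) i => bmat b *ᵥ g i)
      (Measure.pi fun _ => gaussianVec d 1) (Measure.pi fun _ => gaussianVec d 1) :=
  measurePreserving_pi _ _ fun _ => bmat_preserving b

lemma rot_of {N d : ℕ} (b : OrthonormalBasis (Fin d) ℝ (EuclideanSpace ℝ (Fin d)))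
    (g : Fin N → Fin d → ℝ) :
    Matrix.of (fun i => bmat b *ᵥ g i) = Matrix.of g * (bmat b)ᵀ := by
  ext i j
  simp [Matrix.mul_apply, mulVec, dotProduct, mul_comm]

lemma unit_split {n : ℕ} (z : Fin (n+1) → ℝ) (hz : z ≠ 0) :
    ∃ b : OrthonormalBasis (Fin (n+1)) ℝ (EuclideanSpace ℝ (Fin (n+1))),
      z = norm2 z • bmat b 0 := by
  have hp := norm2_pos hz
  obtain ⟨b, hb⟩ := exists_basis_unit ((norm2 z)⁻¹ • z) (by
    rw [← norm2_sq, norm2_smul, abs_of_pos (inv_pos.2 hp), inv_mul_cancel₀ hp.ne', one_pow])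
  exact ⟨b, by rw [hb, smul_smul, mul_inv_cancel₀ hp.ne', one_smul]⟩

lemma row_exp {N n : ℕ} (hN : 0 < N) (z : Fin (n+1) → ℝ) (hz : z ⬝ᵥ z ≤ 5 * N) :
    ∫⁻ g, ENNReal.ofReal (Real.exp ((g ⬝ᵥ z) ^ 2 / (20 * N))) ∂(gaussianVec (n+1) 1) ≤ M2 := by
  have hN' : (0 : ℝ) < N := by exact_mod_cast hN
  by_cases h0 : z = 0
  · simp [h0, one_le_M2]
  obtain ⟨b, hb⟩ := unit_split z h0
  have hle : ∀ g : Fin (n+1) → ℝ, ENNReal.ofReal (Real.exp ((g ⬝ᵥ z) ^ 2 / (20 * N))) ≤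
      (fun y : Fin (n+1) → ℝ => ENNReal.ofReal (Real.exp ((y 0)^2 / 4))) (bmat b *ᵥ g) := by
    intro g
    refine ENNReal.ofReal_le_ofReal (Real.exp_le_exp.2 ?_)
    have : g ⬝ᵥ z = norm2 z * (bmat b *ᵥ g) 0 := by
      conv_lhs => rw [hb]
      rw [dotProduct_smul, dotProduct_comm]; rfl
    rw [this, mul_pow, norm2_sq, div_le_div_iff₀ (by positivity) (by norm_num)]
    nlinarith [sq_nonneg ((bmat b *ᵥ g) 0)]
  refine (lintegral_mono hle).trans ?_
  rw [(bmat_preserving b).lintegral_comp (f := fun y : Fin (n+1) → ℝ => ENNReal.ofReal (Real.exp ((y 0)^2 / 4))) (by fun_prop), gaussianVec_one]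
  exact le_of_eq ((measurePreserving_eval (fun _ : Fin (n+1) => gaussianReal 0 1) 0).lintegral_comp
    (f := fun y => ENNReal.ofReal (Real.exp (y^2 / 4))) (by fun_prop))

lemma exp_moment {N d : ℕ} (hN : 0 < N) (hd : 0 < d) (z : Fin d → ℝ) (hz : z ⬝ᵥ z ≤ 5 * N) :
    ∫⁻ g, ENNReal.ofReal (Real.exp (((Matrix.of g *ᵥ z) ⬝ᵥ (Matrix.of g *ᵥ z)) / (20 * N)))
      ∂(Measure.pi fun _ : Fin N => gaussianVec d 1) ≤ M2 ^ N := by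
  obtain ⟨n, rfl⟩ : ∃ n, d = n + 1 := ⟨d - 1, by omega⟩
  have : ∀ g : Fin N → Fin (n+1) → ℝ,
      ENNReal.ofReal (Real.exp (((Matrix.of g *ᵥ z) ⬝ᵥ (Matrix.of g *ᵥ z)) / (20 * N))) =
      ∏ i ∈ Finset.univ, (fun y => ENNReal.ofReal (Real.exp ((y ⬝ᵥ z) ^ 2 / (20 * N)))) (g i) := by
    intro g
    rw [← ENNReal.ofReal_prod_of_nonneg (fun i _ => (Real.exp_pos _).le), ← Real.exp_sum,
      ← Finset.sum_div]
    simp [dotProduct, mulVec, sq]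
  simp_rw [this]
  have hm : Measurable fun y : Fin (n+1) → ℝ => y ⬝ᵥ z := by unfold dotProduct; fun_prop
  rw [lintegral_pi_prod _ _ (fun y => ENNReal.ofReal (Real.exp ((y ⬝ᵥ z) ^ 2 / (20 * N)))) (by fun_prop)]
  calc _ ≤ ∏ i : Fin N, M2 := Finset.prod_le_prod' fun i _ => row_exp hN z hz
    _ = _ := by simp

lemma exists_orth {N n k : ℕ} (hk : n + k = N) (h : Fin n → Fin N → ℝ) :
    ∃ b : OrthonormalBasis (Fin N) ℝ (EuclideanSpace ℝ (Fin N)),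
      ∀ i : Fin N, (i : ℕ) < k → ∀ j, bmat b i ⬝ᵥ h j = 0 := by
  let V : Submodule ℝ (EuclideanSpace ℝ (Fin N)) :=
    Submodule.span ℝ (Set.range fun j => WithLp.toLp 2 (h j))
  have hV : Module.finrank ℝ V ≤ n := by
    have := finrank_range_le_card (R := ℝ) (fun j => (WithLp.toLp 2 (h j) : EuclideanSpace ℝ (Fin N)))
    rw [Fintype.card_fin] at this
    exact this
  have hVo : k ≤ Module.finrank ℝ Vᗮ := by
    have := V.finrank_add_finrank_orthogonal
    simp at this
    omega
  let e := stdOrthonormalBasis ℝ Vᗮ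
  let v : Fin N → Fin N → ℝ := fun i =>
    if hi : (i : ℕ) < k then ((e ⟨i, by omega⟩ : Vᗮ) : EuclideanSpace ℝ (Fin N)).ofLp else 0
  obtain ⟨b, hb⟩ := exists_basis (k := k) v (by
    intro i j hi hj
    have := orthonormal_iff_ite.1 e.orthonormal ⟨i, by omega⟩ ⟨j, by omega⟩
    simp only [v, hi, hj, dif_pos]
    rw [Submodule.coe_inner, EuclideanSpace.inner_eq_star_dotProduct] at this
    simp only [star_trivial] at this
    rw [dotProduct_comm, this]
    simp [Fin.ext_iff])
  refine ⟨b, fun i hi j => ?_⟩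
  rw [hb i hi]
  simp only [v, hi, dif_pos]
  have hm := (e ⟨i, by omega⟩).2
  have := (Submodule.mem_orthogonal _ _).1 hm (WithLp.toLp 2 (h j)) (Submodule.subset_span ⟨j, rfl⟩)
  simpa [EuclideanSpace.inner_eq_star_dotProduct] using this

lemma row_bound {N n k : ℕ} (G : Matrix (Fin N) (Fin (n+1)) ℝ)
    (b : OrthonormalBasis (Fin N) ℝ (EuclideanSpace ℝ (Fin N)))
    (hb : ∀ i : Fin N, (i : ℕ) < k → ∀ j : Fin n, bmat b i ⬝ᵥ (fun l => G l j.succ) = 0) :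
    (pinv G 0 ⬝ᵥ pinv G 0) *
      ∑ i ∈ Finset.univ.filter (fun i : Fin N => (i : ℕ) < k),
        ((bmat b *ᵥ (fun l => G l 0)) i) ^ 2 ≤ 1 := by
  by_cases hu : IsUnit (Gᵀ * G).det
  swap
  · have : pinv G = 0 := by
      rw [pinv, Matrix.nonsing_inv_apply_not_isUnit _ hu, Matrix.zero_mul]
    have h0 : pinv G 0 = 0 := by rw [this]; rfl
    rw [h0, zero_dotProduct, zero_mul]; norm_num
  set r := pinv G 0 with hr
  set y : Fin (n+1) → ℝ := fun j => (Gᵀ * G)⁻¹ j 0 with hy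
  have hsym : ((Gᵀ * G)⁻¹)ᵀ = (Gᵀ * G)⁻¹ := by
    rw [transpose_nonsing_inv, transpose_mul, transpose_transpose]
  have hrG : r = G *ᵥ y := by
    ext l
    rw [hr, pinv, Matrix.mul_apply]
    simp only [mulVec, dotProduct, hy]
    refine Finset.sum_congr rfl fun j _ => ?_
    have hs : (Gᵀ * G)⁻¹ 0 j = (Gᵀ * G)⁻¹ j 0 := congrFun (congrFun hsym j) 0
    rw [transpose_apply, hs, mul_comm]
  have hGr : Gᵀ *ᵥ r = Pi.single 0 1 := by
    rw [hrG, mulVec_mulVec]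
    have : y = (Gᵀ * G)⁻¹ *ᵥ Pi.single 0 1 := by ext j; simp [hy]
    rw [this, mulVec_mulVec, Matrix.mul_nonsing_inv _ hu, one_mulVec]
  have hrr : r ⬝ᵥ r = y 0 := by
    conv_lhs => rw [hrG]
    rw [dotProduct_comm, dotProduct_mulVec, ← mulVec_transpose, ← hrG, hGr]
    simp
  have hbi : ∀ i : Fin N, (i : ℕ) < k →
      (bmat b *ᵥ r) i = (r ⬝ᵥ r) * (bmat b *ᵥ (fun l => G l 0)) i := by
    intro i hi
    rw [hrr, hrG, mulVec_mulVec]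
    simp only [mulVec]
    rw [dotProduct, Fin.sum_univ_succ]
    have : ∀ j : Fin n, (bmat b * G) i j.succ = 0 := fun j => hb i hi j
    simp only [this, zero_mul, Finset.sum_const_zero, add_zero]
    rw [mul_comm]
    rfl
  have hbes : ∑ i ∈ Finset.univ.filter (fun i : Fin N => (i : ℕ) < k), ((bmat b *ᵥ r) i) ^ 2
      ≤ r ⬝ᵥ r := by
    rw [← bmat_dot b r]
    conv_rhs => rw [dotProduct]
    simp_rw [← sq]
    exact Finset.sum_le_sum_of_subset_of_nonneg (Finset.filter_subset _ _)
      fun i _ _ => sq_nonneg _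
  rw [Finset.sum_congr rfl (fun i hi => by rw [hbi i (Finset.mem_filter.1 hi).2, mul_pow]),
    ← Finset.mul_sum] at hbes
  have h0 : 0 ≤ r ⬝ᵥ r := by rw [← norm2_sq]; positivity
  rcases h0.eq_or_lt with h | h
  · rw [← h]; simp
  · by_contra! hc
    nlinarith

lemma amgm {N k : ℕ} (hk : 0 < k) (S : Finset (Fin N)) (hS : S.card = k) (y : Fin N → ℝ) (t : ℝ)
    (ht : 0 ≤ t) (h : t * ∑ i ∈ S, y i ^ 2 ≤ 1) :
    ENNReal.ofReal t ^ (2 * k / 5 : ℝ) ≤ ENNReal.ofReal k ^ (-(2 * k / 5) : ℝ) *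
      ∏ i ∈ S, ENNReal.ofReal |y i| ^ (-(4/5) : ℝ) := by
  have hk' : (0 : ℝ) < k := by exact_mod_cast hk
  by_cases hz : ∃ i ∈ S, y i = 0
  · obtain ⟨i, hi, hyi⟩ := hz
    have : ∏ i ∈ S, ENNReal.ofReal |y i| ^ (-(4/5) : ℝ) = ∞ := by
      rw [← Finset.mul_prod_erase S _ hi]
      have h1 : ENNReal.ofReal |y i| ^ (-(4/5) : ℝ) = ∞ := by
        rw [hyi, abs_zero, ENNReal.ofReal_zero, ENNReal.zero_rpow_of_neg (by norm_num)]
      rw [h1, ENNReal.top_mul]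
      refine Finset.prod_ne_zero_iff.2 fun j _ => ?_
      simp only [ne_eq, ENNReal.rpow_eq_zero_iff, not_or, not_and]
      exact ⟨fun _ => by norm_num, fun h => absurd h ENNReal.ofReal_ne_top⟩
    rw [this, ENNReal.mul_top]
    · exact le_top
    · simp [ENNReal.rpow_eq_zero_iff]
      intro; positivity
  push Not at hz
  have hpos : ∀ i ∈ S, 0 < |y i| := fun i hi => abs_pos.2 (hz i hi)
  have hP : 0 < ∏ i ∈ S, |y i| ^ (-(4/5) : ℝ) :=
    Finset.prod_pos fun i hi => Real.rpow_pos_of_pos (hpos i hi) _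
  have ham := Real.geom_mean_le_arith_mean_weighted S (fun _ => (k : ℝ)⁻¹) (fun i => y i ^ 2)
    (fun i _ => by positivity) (by simp [hS, hk'.ne']) (fun i _ => sq_nonneg _)
  rw [← Finset.mul_sum] at ham
  set Q := ∏ i ∈ S, (y i ^ 2) ^ ((k : ℝ)⁻¹) with hQ
  have hQp : 0 < Q := Finset.prod_pos fun i hi => Real.rpow_pos_of_pos (by
    have := hz i hi; positivity) _
  have ht1 : t ≤ (k * Q)⁻¹ := by
    rw [← one_div, le_div_iff₀ (by positivity)]
    refine le_trans ?_ h
    gcongr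
    rwa [inv_mul_eq_div, le_div_iff₀ hk', mul_comm] at ham
  have hreal : t ^ (2 * k / 5 : ℝ) ≤ (k : ℝ) ^ (-(2 * k / 5) : ℝ) * ∏ i ∈ S, |y i| ^ (-(4/5) : ℝ) := by
    calc _ ≤ ((k * Q)⁻¹) ^ (2 * k / 5 : ℝ) := Real.rpow_le_rpow ht ht1 (by positivity)
      _ = (k * Q) ^ (-(2 * k / 5) : ℝ) := by
        rw [Real.inv_rpow (by positivity), Real.rpow_neg (by positivity)]
      _ = (k : ℝ) ^ (-(2 * k / 5) : ℝ) * Q ^ (-(2 * k / 5) : ℝ) :=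
        Real.mul_rpow hk'.le hQp.le
      _ = _ := by
        congr 1
        rw [hQ, ← Real.finsetProd_rpow _ _ (fun i _ => Real.rpow_nonneg (sq_nonneg _) _)]
        refine Finset.prod_congr rfl fun i hi => ?_
        rw [← sq_abs, ← Real.rpow_natCast, ← Real.rpow_mul (abs_nonneg _),
          ← Real.rpow_mul (abs_nonneg _)]
        congr 1
        push_cast
        field_simp
        norm_num
  rw [ENNReal.ofReal_rpow_of_nonneg ht (by positivity), ENNReal.ofReal_rpow_of_pos hk',
    Finset.prod_congr rfl (fun i hi => ENNReal.ofReal_rpow_of_pos (hpos i hi)),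
    ← ENNReal.ofReal_prod_of_nonneg (fun i hi => Real.rpow_nonneg (abs_nonneg _) _),
    ← ENNReal.ofReal_mul (by positivity)]
  exact ENNReal.ofReal_le_ofReal hreal

lemma split_preserving (N n : ℕ) :
    ∃ e : (Fin N → ℝ) × (Fin N → Fin n → ℝ) → (Fin N → Fin (n+1) → ℝ),
      MeasurePreserving e ((gaussianVec N 1).prod (Measure.pi fun _ => gaussianVec n 1))
        (Measure.pi fun _ => gaussianVec (n+1) 1) ∧
      (∀ q i, e q i 0 = q.1 i) ∧ ∀ q i j, e q i (Fin.succ j) = q.2 i j := by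
  have h1 := (measurePreserving_arrowProdEquivProdArrow ℝ (Fin n → ℝ) (Fin N)
    (fun _ => gaussianReal 0 1) (fun _ => gaussianVec n 1)).symm
  have h2 : MeasurePreserving
      (fun (a : Fin N → ℝ × (Fin n → ℝ)) i => (MeasurableEquiv.piFinSuccAbove (fun _ : Fin (n+1) => ℝ) 0).symm (a i))
      (Measure.pi fun _ => (gaussianReal 0 1).prod (gaussianVec n 1))
      (Measure.pi fun _ => gaussianVec (n+1) 1) := by
    refine measurePreserving_pi _ _ fun i => ?_
    rw [gaussianVec_one, gaussianVec_one]
    exact (measurePreserving_piFinSuccAbove (fun _ : Fin (n+1) => gaussianReal 0 1) 0).symm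
  rw [← gaussianVec_one] at h1
  exact ⟨_, h2.comp h1, fun q i => rfl, fun q i j => rfl⟩

lemma meas_pinv {N d : ℕ} (i : Fin d) (j : Fin N) :
    Measurable fun g : Fin N → Fin d → ℝ => pinv (Matrix.of g) i j := by
  simp only [pinv, Matrix.inv_def, Ring.inverse_eq_inv', Matrix.mul_apply, Matrix.smul_apply, smul_eq_mul]
  have hc : Continuous fun g : Fin N → Fin d → ℝ => (Matrix.of g)ᵀ * Matrix.of g := by
    have : Continuous fun g : Fin N → Fin d → ℝ => Matrix.of g := continuous_id
    fun_prop
  have h1 : Measurable fun g : Fin N → Fin d → ℝ => ((Matrix.of g)ᵀ * Matrix.of g).det :=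
    hc.matrix_det.measurable
  have h2 : ∀ a b, Measurable fun g : Fin N → Fin d → ℝ => ((Matrix.of g)ᵀ * Matrix.of g).adjugate a b :=
    fun a b => (hc.matrix_adjugate.matrix_elem a b).measurable
  refine Finset.measurable_sum _ fun l _ => ?_
  refine (h1.inv.mul (h2 i l)).mul ?_
  simp only [transpose_apply, of_apply]
  fun_prop

lemma meas_T {N d : ℕ} : Measurable fun q : (Fin N → Fin d → ℝ) × (Fin d → ℝ) =>
    ((pinv (Matrix.of q.1))ᵀ *ᵥ q.2) ⬝ᵥ ((pinv (Matrix.of q.1))ᵀ *ᵥ q.2) := by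
  simp only [dotProduct, mulVec, transpose_apply]
  have : ∀ (i : Fin d) (j : Fin N), Measurable fun q : (Fin N → Fin d → ℝ) × (Fin d → ℝ) =>
      pinv (Matrix.of q.1) i j := fun i j => (meas_pinv i j).comp measurable_fst
  fun_prop

def rowF {N n : ℕ} (k : ℕ) (g : Fin N → Fin (n+1) → ℝ) : ℝ≥0∞ :=
  ENNReal.ofReal (pinv (Matrix.of g) 0 ⬝ᵥ pinv (Matrix.of g) 0) ^ (2 * k / 5 : ℝ)

lemma meas_rowF {N n : ℕ} (k : ℕ) : Measurable (rowF (N := N) (n := n) k) := by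
  unfold rowF
  simp only [dotProduct]
  have := fun j => meas_pinv (N := N) (d := n+1) 0 j
  fun_prop

lemma row_moment {N n k : ℕ} (hk : n + k = N) (hk0 : 0 < k) :
    ∫⁻ g, rowF k g
      ∂(Measure.pi fun _ : Fin N => gaussianVec (n+1) 1) ≤
      ENNReal.ofReal k ^ (-(2 * k / 5) : ℝ) * M1 ^ k := by
  obtain ⟨e, he, he0, hes⟩ := split_preserving N n
  have hmeas := meas_rowF (N := N) (n := n) k
  have hm2 : Measurable fun q => rowF k (e q) := hmeas.comp he.measurable
  rw [← he.lintegral_comp hmeas, lintegral_prod_symm' _ hm2]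
  have hin : ∀ rest : Fin N → Fin n → ℝ, ∫⁻ c, rowF k (e (c, rest))
      ∂(gaussianVec N 1) ≤ ENNReal.ofReal k ^ (-(2 * k / 5) : ℝ) * M1 ^ k := by
    intro rest
    obtain ⟨b, hb⟩ := exists_orth hk (fun j l => rest l j)
    set S := Finset.univ.filter (fun i : Fin N => (i : ℕ) < k) with hS
    have hcard : S.card = k := by
      rw [hS, Fin.card_filter_val_lt]; omega
    have hmf : Measurable fun y : Fin N → ℝ => ∏ i ∈ S, ENNReal.ofReal |y i| ^ (-(4/5) : ℝ) := by
      fun_prop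
    calc _ ≤ ∫⁻ c, ENNReal.ofReal k ^ (-(2 * k / 5) : ℝ) *
          (fun y : Fin N → ℝ => ∏ i ∈ S, ENNReal.ofReal |y i| ^ (-(4/5) : ℝ)) (bmat b *ᵥ c)
            ∂(gaussianVec N 1) := by
          refine lintegral_mono fun c => ?_
          refine amgm hk0 S hcard _ _ (by rw [← norm2_sq]; positivity) ?_
          have := row_bound (k := k) (Matrix.of (e (c, rest))) b (by
            intro i hi j
            simp only [of_apply, hes]
            exact hb i hi j)
          simpa only [of_apply, he0] using this
      _ = ENNReal.ofReal k ^ (-(2 * k / 5) : ℝ) * M1 ^ k := by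
          have hm3 : Measurable fun c => (fun y : Fin N → ℝ => ∏ i ∈ S, ENNReal.ofReal |y i| ^ (-(4/5) : ℝ)) (bmat b *ᵥ c) :=
            hmf.comp (bmat_preserving b).measurable
          rw [lintegral_const_mul _ hm3, (bmat_preserving b).lintegral_comp hmf, gaussianVec_one,
            lintegral_pi_prod _ S (fun y => ENNReal.ofReal |y| ^ (-(4/5) : ℝ)) (by fun_prop)]
          rw [Finset.prod_const, hcard]
          rfl
  calc _ ≤ ∫⁻ rest, ENNReal.ofReal k ^ (-(2 * k / 5) : ℝ) * M1 ^ k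
        ∂(Measure.pi fun _ : Fin N => gaussianVec n 1) := lintegral_mono hin
    _ = _ := by simp

lemma inv_moment {N d k : ℕ} (hd : 0 < d) (hk : d + k = N + 1) (hk0 : 0 < k)
    (z : Fin d → ℝ) (hz : z ⬝ᵥ z ≤ 5 * N) :
    ∫⁻ g, ENNReal.ofReal (((pinv (Matrix.of g))ᵀ *ᵥ z) ⬝ᵥ ((pinv (Matrix.of g))ᵀ *ᵥ z)) ^ (2 * k / 5 : ℝ)
      ∂(Measure.pi fun _ : Fin N => gaussianVec d 1) ≤
      ENNReal.ofReal (5 * N) ^ (2 * k / 5 : ℝ) *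
        (ENNReal.ofReal k ^ (-(2 * k / 5) : ℝ) * M1 ^ k) := by
  obtain ⟨n, rfl⟩ : ∃ n, d = n + 1 := ⟨d - 1, by omega⟩
  have hk' : (0 : ℝ) < k := by exact_mod_cast hk0
  by_cases h0 : z = 0
  · simp [h0, hk']
  obtain ⟨b, hb⟩ := unit_split z h0
  have hQu : IsUnit (bmat b).det := by
    have := congrArg det (bmat_mul b)
    rw [det_mul, det_one] at this
    exact IsUnit.of_mul_eq_one _ this
  have hQi : (bmat b)⁻¹ = (bmat b)ᵀ := Matrix.inv_eq_right_inv (bmat_mul b)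
  have hQz : bmat b *ᵥ z = norm2 z • Pi.single 0 1 := by
    conv_lhs => rw [hb]
    rw [mulVec_smul]
    congr 1
    ext i
    have := congrFun (congrFun (bmat_mul b) i) 0
    rw [Matrix.one_apply] at this
    rw [Pi.single_apply, ← this]
    rfl
  have hmeas := meas_rowF (N := N) (n := n) k
  have hpt : ∀ g : Fin N → Fin (n+1) → ℝ,
      ENNReal.ofReal (((pinv (Matrix.of g))ᵀ *ᵥ z) ⬝ᵥ ((pinv (Matrix.of g))ᵀ *ᵥ z)) ^ (2 * k / 5 : ℝ)
      ≤ ENNReal.ofReal (5 * N) ^ (2 * k / 5 : ℝ) *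
       rowF k (fun i => bmat b *ᵥ g i) := by
    intro g
    unfold rowF
    rw [rot_of, pinv_mul_transpose _ hQu, hQi, transpose_transpose]
    have : (pinv (Matrix.of g))ᵀ *ᵥ z = norm2 z • (bmat b * pinv (Matrix.of g)) 0 := by
      have h1 : (bmat b * pinv (Matrix.of g))ᵀ *ᵥ (bmat b *ᵥ z) = (pinv (Matrix.of g))ᵀ *ᵥ z := by
        rw [transpose_mul, mulVec_mulVec, Matrix.mul_assoc, bmat_mul', Matrix.mul_one]
      rw [← h1, hQz, mulVec_smul]
      congr 1
      rw [mulVec_single_one]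
      rfl
    rw [this, smul_dotProduct, dotProduct_smul, smul_eq_mul, smul_eq_mul, ← mul_assoc, ← sq,
      norm2_sq, ENNReal.ofReal_mul (by rw [← norm2_sq]; positivity),
      ENNReal.mul_rpow_of_nonneg _ _ (by positivity)]
    gcongr
  refine (lintegral_mono hpt).trans ?_
  have hm3 : Measurable fun g : Fin N → Fin (n+1) → ℝ => rowF k (fun i => bmat b *ᵥ g i) :=
    hmeas.comp (rot_preserving b).measurable
  rw [lintegral_const_mul _ hm3,
    (rot_preserving b).lintegral_comp hmeas]
  gcongr
  exact row_moment (by omega) hk0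

lemma ball_le {d : ℕ} (s : Set (Fin d → ℝ)) (hs : MeasurableSet s) (f : (Fin d → ℝ) → ℝ≥0∞) (c : ℝ≥0∞)
    (h : ∀ z ∈ s, f z ≤ c) : ∫⁻ z in s, f z ∂(gaussianVec d 1) ≤ c := by
  calc _ ≤ ∫⁻ z in s, c ∂(gaussianVec d 1) := setLIntegral_mono' hs h
    _ = c * gaussianVec d 1 s := by simp
    _ ≤ c * 1 := by gcongr; exact prob_le_one
    _ = c := mul_one _

lemma meas_ball {N d : ℕ} : MeasurableSet {z : Fin d → ℝ | z ⬝ᵥ z ≤ 5 * N} := by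
  have : Measurable fun z : Fin d → ℝ => z ⬝ᵥ z := by unfold dotProduct; fun_prop
  exact measurableSet_le this measurable_const

def Sfun {N d : ℕ} (p : ℝ) (g : Fin N → Fin d → ℝ) : ℝ≥0∞ :=
  ∫⁻ z in {z | z ⬝ᵥ z ≤ 5 * N}, ENNReal.ofReal
    (((pinv (Matrix.of g))ᵀ *ᵥ z) ⬝ᵥ ((pinv (Matrix.of g))ᵀ *ᵥ z)) ^ p ∂(gaussianVec d 1)

def Efun {N d : ℕ} (g : Fin N → Fin d → ℝ) : ℝ≥0∞ :=
  ∫⁻ z in {z | z ⬝ᵥ z ≤ 5 * N}, ENNReal.ofReal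
    (Real.exp (((Matrix.of g *ᵥ z) ⬝ᵥ (Matrix.of g *ᵥ z)) / (20 * N))) ∂(gaussianVec d 1)

lemma meas_S' {N d : ℕ} (p : ℝ) : Measurable fun q : (Fin N → Fin d → ℝ) × (Fin d → ℝ) =>
    ENNReal.ofReal (((pinv (Matrix.of q.1))ᵀ *ᵥ q.2) ⬝ᵥ ((pinv (Matrix.of q.1))ᵀ *ᵥ q.2)) ^ p := by
  have := meas_T (N := N) (d := d)
  fun_prop

lemma meas_E' {N d : ℕ} : Measurable fun q : (Fin N → Fin d → ℝ) × (Fin d → ℝ) =>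
    ENNReal.ofReal (Real.exp (((Matrix.of q.1 *ᵥ q.2) ⬝ᵥ (Matrix.of q.1 *ᵥ q.2)) / (20 * N))) := by
  simp only [dotProduct, mulVec, of_apply]
  fun_prop

lemma meas_S {N d : ℕ} (p : ℝ) : Measurable (Sfun (N := N) (d := d) p) :=
  (meas_S' p).lintegral_prod_right'

lemma meas_E {N d : ℕ} : Measurable (Efun (N := N) (d := d)) :=
  meas_E'.lintegral_prod_right'

lemma S_bound {N d k : ℕ} (hd : 0 < d) (hk : d + k = N + 1) (hk0 : 0 < k) :
    ∫⁻ g, Sfun (2 * k / 5 : ℝ) g ∂(Measure.pi fun _ : Fin N => gaussianVec d 1) ≤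
      ENNReal.ofReal (5 * N) ^ (2 * k / 5 : ℝ) *
        (ENNReal.ofReal k ^ (-(2 * k / 5) : ℝ) * M1 ^ k) := by
  unfold Sfun
  rw [lintegral_lintegral_swap (meas_S' _).aemeasurable]
  exact ball_le _ meas_ball _ _ fun z hz => inv_moment hd hk hk0 z hz

lemma E_bound {N d : ℕ} (hN : 0 < N) (hd : 0 < d) :
    ∫⁻ g, Efun g ∂(Measure.pi fun _ : Fin N => gaussianVec d 1) ≤ M2 ^ N := by
  unfold Efun
  rw [lintegral_lintegral_swap meas_E'.aemeasurable]
  exact ball_le _ meas_ball _ _ fun z hz => exp_moment hN hd z hz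

/-- generic: turn a lower bound on `F` plus a bound on its integral into domination -/
lemma dominate {α : Type*} [MeasurableSpace α] (μ : Measure α) [IsProbabilityMeasure μ]
    (F : α → ℝ≥0∞) (hF : Measurable F) (a D : ℝ) (ha : 0 < a) (hD : 0 < D)
    (hint : ∫⁻ g, F g ∂μ ≤ ENNReal.ofReal D) (w x : α → ℝ) (hw : ∀ g, 0 ≤ w g)
    (hlow : ∀ g, ENNReal.ofReal (a * D * w g) ≤ F g) (b : ℝ) (hb : 0 < b)
    (hx : ∀ g, x g ≤ b * (1 + w g)) :
    ∃ T : α → ℝ≥0∞, Measurable T ∧ ∫⁻ g, T g ∂μ ≤ ENNReal.ofReal (b * (1 + a⁻¹)) ∧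
      ∀ g, ENNReal.ofReal (x g) ≤ T g := by
  refine ⟨fun g => ENNReal.ofReal b * (1 + ENNReal.ofReal ((a * D)⁻¹) * F g), by fun_prop, ?_, ?_⟩
  · rw [lintegral_const_mul _ (by fun_prop), lintegral_add_left (by fun_prop),
      lintegral_const_mul _ hF, ENNReal.ofReal_mul hb.le, ENNReal.ofReal_add (by norm_num) (by positivity)]
    simp only [lintegral_const, measure_univ, mul_one, ENNReal.ofReal_one]
    refine mul_le_mul_right (add_le_add_right ?_ _) _
    calc _ ≤ ENNReal.ofReal ((a * D)⁻¹) * ENNReal.ofReal D := by gcongr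
      _ = _ := by
        rw [← ENNReal.ofReal_mul (by positivity)]
        congr 1
        field_simp
  · intro g
    refine (ENNReal.ofReal_le_ofReal (hx g)).trans ?_
    rw [ENNReal.ofReal_mul hb.le, ENNReal.ofReal_add (by norm_num) (hw g), ENNReal.ofReal_one]
    refine mul_le_mul_right (add_le_add_right ?_ _) _
    calc ENNReal.ofReal (w g) = ENNReal.ofReal ((a * D)⁻¹) * ENNReal.ofReal (a * D * w g) := by
          rw [← ENNReal.ofReal_mul (by positivity)]
          congr 1
          field_simp
      _ ≤ _ := by gcongr; exact hlow g

def b1 : ℝ := 25 / 2 * Real.exp 1 * M1.toReal ^ (5 / 2 : ℝ)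

lemma M1r_pos : 0 < M1.toReal := ENNReal.toReal_pos M1_pos.ne' M1_lt.ne

lemma b1_pos : 0 < b1 := by
  have := M1r_pos
  unfold b1; positivity

lemma dom1 {N d k : ℕ} (hd : 0 < d) (hk : d + k = N + 1) (hk0 : 5 ≤ k) :
    ∃ T : (Fin N → Fin d → ℝ) → ℝ≥0∞, Measurable T ∧
      ∫⁻ g, T g ∂(Measure.pi fun _ : Fin N => gaussianVec d 1) ≤
        ENNReal.ofReal (b1 ^ 2 * (1 + c0⁻¹)) ∧
      ∀ g, ENNReal.ofReal ((spec (pinv (Matrix.of g)) ^ 2 * k ^ 2 / N) ^ 2) ≤ T g := by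
  have hk5 : (5 : ℝ) ≤ k := by exact_mod_cast hk0
  have hkp : (0 : ℝ) < k := by linarith
  have hNd : d ≤ N := by omega
  have hN : 0 < N := by omega
  have hNp : (0 : ℝ) < N := by exact_mod_cast hN
  have hkN : (k : ℝ) ≤ N := by exact_mod_cast (by omega : k ≤ N)
  have hM := M1r_pos
  have hb := b1_pos
  obtain ⟨p, hp⟩ : ∃ p : ℝ, p = 2 * k / 5 := ⟨_, rfl⟩
  have hp2 : 2 ≤ p := by rw [hp]; linarith
  have hp0 : 0 < p := by linarith
  set D : ℝ := (5 * N) ^ p * (k ^ (-p) * M1.toReal ^ k) with hDdef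
  have hD : 0 < D := by positivity
  refine dominate _ (Sfun p) (meas_S p) c0 D c0_pos hD ?_
    (fun g => ((spec (pinv (Matrix.of g)) ^ 2 * k ^ 2 / N) / b1) ^ p) _ (fun g => by positivity) ?_
    (b1 ^ 2) (by positivity) ?_
  · have := S_bound (N := N) hd hk (by omega)
    rw [← hp] at this
    refine this.trans (le_of_eq ?_)
    rw [hDdef, ENNReal.ofReal_mul (p := (5 * (N:ℝ)) ^ p) (by positivity),
      ENNReal.ofReal_mul (p := (k:ℝ) ^ (-p)) (by positivity),
      ENNReal.ofReal_rpow_of_pos (by positivity), ENNReal.ofReal_rpow_of_pos (by positivity),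
      ENNReal.ofReal_pow hM.le, ENNReal.ofReal_toReal M1_lt.ne]
  · intro g
    have hs := smoothing (N := N) hN hd hNd p hp0.le (by rw [hp]; linarith) (pinv (Matrix.of g))ᵀ
      (fun s => ENNReal.ofReal s ^ p) (fun s t hst =>
        ENNReal.rpow_le_rpow (ENNReal.ofReal_le_ofReal hst) hp0.le)
    refine le_trans (le_of_eq ?_) hs
    rw [spec_transpose hd hN]
    set m := spec (pinv (Matrix.of g)) ^ 2 with hm
    have hm0 : 0 ≤ m := by positivity
    rw [ENNReal.ofReal_rpow_of_nonneg (by positivity) hp0.le, ← ENNReal.ofReal_mul (by have := c0_pos; positivity)]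
    congr 1
    rw [mul_assoc c0, mul_assoc c0]
    congr 1
    have e1 : Real.exp (-p) = Real.exp (-1) ^ p := by rw [← Real.exp_mul]; ring_nf
    have e2 : M1.toReal ^ k = (M1.toReal ^ (5/2 : ℝ)) ^ p := by
      rw [← Real.rpow_mul hM.le, ← Real.rpow_natCast]
      congr 1; rw [hp]; ring
    have e3 : (k : ℝ) ^ (-p) = ((k : ℝ)⁻¹) ^ p := by
      rw [Real.rpow_neg hkp.le, Real.inv_rpow hkp.le]
    rw [hDdef, e1, e2, e3]
    rw [← Real.mul_rpow (by positivity) (by positivity), ← Real.mul_rpow (by positivity) (by positivity),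
      ← Real.mul_rpow (by positivity) (by positivity), ← Real.mul_rpow (by positivity) (by positivity)]
    congr 1
    rw [b1, Real.exp_neg, hp]
    field_simp
    ring
  · intro g
    set x := spec (pinv (Matrix.of g)) ^ 2 * k ^ 2 / N with hx
    have hx0 : 0 ≤ x := by positivity
    have h1 : (x / b1) ^ 2 ≤ 1 + (x / b1) ^ p := by
      have hy : 0 ≤ x / b1 := by positivity
      rcases le_total (x / b1) 1 with h | h
      · have : (x / b1) ^ 2 ≤ 1 := pow_le_one₀ hy h
        have := Real.rpow_nonneg hy p
        linarith
      · have : (x / b1) ^ (2:ℝ) ≤ (x / b1) ^ p := Real.rpow_le_rpow_of_exponent_le h hp2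
        rw [Real.rpow_two] at this
        linarith
    calc x ^ 2 = b1 ^ 2 * (x / b1) ^ 2 := by field_simp
      _ ≤ _ := by gcongr

def b2 : ℝ := Real.exp 1 * M2.toReal

lemma b2_pos : 0 < b2 := by
  have : 0 < M2.toReal := ENNReal.toReal_pos (by have := one_le_M2; positivity) M2_lt.ne
  unfold b2; positivity

lemma dom2 {N d : ℕ} (hd : 0 < d) (hNd : d ≤ N) :
    ∃ T : (Fin N → Fin d → ℝ) → ℝ≥0∞, Measurable T ∧
      ∫⁻ g, T g ∂(Measure.pi fun _ : Fin N => gaussianVec d 1) ≤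
        ENNReal.ofReal (800 * b2 * (1 + c0⁻¹)) ∧
      ∀ g, ENNReal.ofReal ((spec (Matrix.of g) ^ 2 / N) ^ 2) ≤ T g := by
  have hN : 0 < N := by omega
  have hNp : (0 : ℝ) < N := by exact_mod_cast hN
  have hb := b2_pos
  have hM : 0 < M2.toReal := ENNReal.toReal_pos (by have := one_le_M2; positivity) M2_lt.ne
  refine dominate _ Efun meas_E c0 (M2.toReal ^ N) c0_pos (by positivity) ?_
    (fun g => (Real.exp (spec (Matrix.of g) ^ 2 / N / 20) / b2) ^ N) _ (fun g => by positivity) ?_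
    (800 * b2) (by positivity) ?_
  · rw [ENNReal.ofReal_pow hM.le, ENNReal.ofReal_toReal M2_lt.ne]
    exact E_bound hN hd
  · intro g
    have hs := smoothing (N := N) hN hd hNd N hNp.le le_rfl (Matrix.of g)
      (fun s => ENNReal.ofReal (Real.exp (s / (20 * N)))) (fun s t hst =>
        ENNReal.ofReal_le_ofReal (Real.exp_le_exp.2 (by gcongr)))
    refine le_trans (le_of_eq ?_) hs
    set m := spec (Matrix.of g) ^ 2 with hm
    rw [← ENNReal.ofReal_mul (by have := c0_pos; positivity)]
    congr 1
    rw [mul_assoc c0, mul_assoc c0]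
    congr 1
    have e1 : Real.exp (-N) = Real.exp (-1) ^ N := by rw [← Real.exp_nat_mul]; ring_nf
    have e2 : Real.exp (N * m / (20 * N)) = Real.exp (m / N / 20) ^ N := by
      rw [← Real.exp_nat_mul]; congr 1; field_simp
    rw [e1, e2, ← mul_pow, ← mul_pow]
    congr 1
    rw [b2, Real.exp_neg]
    field_simp
  · intro g
    set x := spec (Matrix.of g) ^ 2 / N with hx
    have hx0 : 0 ≤ x := by positivity
    set y := Real.exp (x / 20) / b2 with hy
    have hy0 : 0 ≤ y := by positivity
    have h1 : y ≤ 1 + y ^ N := by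
      rcases le_total y 1 with h | h
      · have := pow_nonneg hy0 N
        linarith
      · have := le_self_pow₀ h hN.ne'
        linarith
    have h2 := Real.quadratic_le_exp_of_nonneg (show 0 ≤ x / 20 by positivity)
    have h3 : Real.exp (x / 20) = b2 * y := by rw [hy]; field_simp
    calc x ^ 2 ≤ 800 * Real.exp (x / 20) := by nlinarith
      _ = 800 * b2 * y := by rw [h3]; ring
      _ ≤ _ := by gcongr

theorem expected_sq_condition_number :
    ∃ C₄ : ℝ, 0 < C₄ ∧
      ∀ (N d : ℕ), 2 ≤ d → d + 3 < N →
      ∀ (Sigx A : Matrix (Fin d) (Fin d) ℝ), Sigx.PosDef → A * Aᵀ = Sigx →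
        (∫ g, spec (pinv (Matrix.of g * Aᵀ)) ^ 2 * spec (Matrix.of g * Aᵀ) ^ 2
            ∂(Measure.pi fun _ : Fin N => gaussianVec d 1)) ≤
          C₄ * (spec Sigx / sMin Sigx) *
            ((Real.sqrt N + Real.sqrt d) /
              (Real.sqrt N - ((d : ℝ) + 3) / Real.sqrt N)) ^ 2 := by
  have hb1 := b1_pos
  have hb2 := b2_pos
  have hc0 := c0_pos
  set C1 := b1 ^ 2 * (1 + c0⁻¹) with hC1
  set C2 := 800 * b2 * (1 + c0⁻¹) with hC2
  have hC1p : 0 < C1 := by positivity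
  have hC2p : 0 < C2 := by positivity
  refine ⟨C1 + C2, by positivity, ?_⟩
  intro N d hd hN Sigx A hS hA
  obtain ⟨k, hk⟩ : ∃ k, d + k = N + 1 := ⟨N + 1 - d, by omega⟩
  have hk5 : 5 ≤ k := by omega
  have hkp : (0 : ℝ) < k := by exact_mod_cast (by omega : 0 < k)
  have hNp : (0 : ℝ) < N := by exact_mod_cast (by omega : 0 < N)
  have hkr : (d : ℝ) + k = N + 1 := by exact_mod_cast hk
  have hNr : (d : ℝ) + 3 < N := by exact_mod_cast hN
  obtain ⟨T1, hT1m, hT1i, hT1⟩ := dom1 (N := N) (d := d) (by omega) hk hk5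
  obtain ⟨T2, hT2m, hT2i, hT2⟩ := dom2 (N := N) (d := d) (by omega) (by omega)
  set κ := spec Sigx / sMin Sigx with hκ
  have hκ0 : 0 ≤ κ := by
    refine div_nonneg (spec_nonneg (by omega) _) (Real.sInf_nonneg ?_)
    rintro c ⟨x, -, rfl⟩
    exact norm2_nonneg _
  set Q : ℝ := N ^ 2 / k ^ 2 with hQ
  have hQ0 : 0 ≤ Q := by positivity
  have hRHS : Q ≤ ((Real.sqrt N + Real.sqrt d) /
              (Real.sqrt N - ((d : ℝ) + 3) / Real.sqrt N)) ^ 2 := by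
    have hs : 0 < Real.sqrt N := Real.sqrt_pos.2 hNp
    have hss : Real.sqrt N * Real.sqrt N = N := Real.mul_self_sqrt hNp.le
    have e : Real.sqrt N - ((d : ℝ) + 3) / Real.sqrt N = (N - d - 3) / Real.sqrt N := by
      rw [eq_div_iff hs.ne', sub_mul, hss, div_mul_cancel₀ _ hs.ne']; ring
    rw [hQ, ← div_pow, e, div_div_eq_mul_div]
    have h1 : (0 : ℝ) < N - d - 3 := by linarith
    refine pow_le_pow_left₀ (by positivity) ?_ 2
    refine div_le_div₀ (by positivity) ?_ h1 (by linarith)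
    have := mul_nonneg (Real.sqrt_nonneg d) hs.le
    linarith [add_mul (Real.sqrt N) (Real.sqrt d) (Real.sqrt N)]
  have hfin : 0 ≤ (C1 + C2) * κ * Q := by positivity
  have hmono : (C1 + C2) * κ * Q ≤ (C1 + C2) * κ * ((Real.sqrt N + Real.sqrt d) /
              (Real.sqrt N - ((d : ℝ) + 3) / Real.sqrt N)) ^ 2 := by gcongr
  refine le_trans ?_ hmono
  by_cases hint : Integrable (fun g : Fin N → Fin d → ℝ =>
    spec (pinv (Matrix.of g * Aᵀ)) ^ 2 * spec (Matrix.of g * Aᵀ) ^ 2)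
    (Measure.pi fun _ : Fin N => gaussianVec d 1)
  swap
  · rw [integral_undef hint]; exact hfin
  rw [integral_eq_lintegral_of_nonneg_ae (Filter.Eventually.of_forall fun g => by positivity)
    hint.aestronglyMeasurable]
  refine ENNReal.toReal_le_of_le_ofReal hfin ?_
  calc _ ≤ ∫⁻ g, ENNReal.ofReal (κ * Q) * (T1 g + T2 g)
        ∂(Measure.pi fun _ : Fin N => gaussianVec d 1) := by
        refine lintegral_mono fun g => ?_
        refine le_trans ?_ (mul_le_mul_right (add_le_add (hT1 g) (hT2 g)) _)
        rw [← ENNReal.ofReal_add (by positivity) (by positivity),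
          ← ENNReal.ofReal_mul (by positivity)]
        refine ENNReal.ofReal_le_ofReal ?_
        refine (det_reduction (by omega) (by omega) Sigx A hS hA (Matrix.of g)).1.trans ?_
        rw [mul_assoc κ Q]
        refine mul_le_mul_of_nonneg_left ?_ hκ0
        set m := spec (pinv (Matrix.of g)) ^ 2 with hm
        set l := spec (Matrix.of g) ^ 2 with hl
        have hm0 : 0 ≤ m := by positivity
        have hl0 : 0 ≤ l := by positivity
        have e : m * l = Q * ((m * k ^ 2 / N) * (l / N)) := by
          rw [hQ]; field_simp
        rw [e]
        gcongr
        have : 0 ≤ (m * k ^ 2 / N) * (l / N) := by positivity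
        nlinarith [sq_nonneg (m * k ^ 2 / N - l / N)]
    _ = ENNReal.ofReal (κ * Q) * (∫⁻ g, T1 g ∂(Measure.pi fun _ : Fin N => gaussianVec d 1) +
          ∫⁻ g, T2 g ∂(Measure.pi fun _ : Fin N => gaussianVec d 1)) := by
        rw [lintegral_const_mul _ (by fun_prop), lintegral_add_left hT1m]
    _ ≤ ENNReal.ofReal (κ * Q) * (ENNReal.ofReal C1 + ENNReal.ofReal C2) := by gcongr
    _ = _ := by
        rw [← ENNReal.ofReal_add hC1p.le hC2p.le, ← ENNReal.ofReal_mul (by positivity)]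
        congr 1
        ring

end Stmt10
end
end

section
/- Let G be an n×m random matrix with n ≥ m ≥ 2 and i.i.d. entries drawn from N(0,1), and let p be a positive integer with n > m + p − 1. Then E||G†||^p ≤ (e√n/(n − m − p + 1))^p, where G† is the Moore–Penrose pseudoinverse and ||G†|| = 1/σ_min(G) with σ_min(G) the smallest singular value of G. -/
open MeasureTheory ProbabilityTheory Matrix

noncomputable section

namespace Stmt13

/-- Euclidean norm of a vector in `ℝ^n`. -/
def norm2 {n : ℕ} (v : Fin n → ℝ) : ℝ := Real.sqrt (∑ i, v i ^ 2)

/-- Spectral norm (`ℓ₂` operator norm) of a real matrix. -/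
def spec {m n : ℕ} (A : Matrix (Fin m) (Fin n) ℝ) : ℝ :=
  sSup {c : ℝ | ∃ x : Fin n → ℝ, norm2 x = 1 ∧ c = norm2 (A *ᵥ x)}

/-- `(GᵀG)⁻¹Gᵀ`, the Moore–Penrose pseudoinverse of a full-column-rank matrix,
whose spectral norm is `1/σ_min(G)`. -/
def pinv {n m : ℕ} (G : Matrix (Fin n) (Fin m) ℝ) : Matrix (Fin m) (Fin n) ℝ :=
  (Gᵀ * G)⁻¹ * Gᵀ

/-- Law of a matrix with i.i.d. standard Gaussian entries. -/
def stdGaussianMat (n m : ℕ) : Measure (Fin n → Fin m → ℝ) :=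
  Measure.pi fun _ => Measure.pi fun _ => gaussianReal 0 1

abbrev gam (k : ℕ) : Measure (Fin k → ℝ) := Measure.pi fun _ => gaussianReal 0 1

lemma law {k l : ℕ} (A : Matrix (Fin k) (Fin l) ℝ) (hA : A * Aᵀ = 1) :
    MeasurePreserving (fun x : Fin l → ℝ => A *ᵥ x) (gam l) (gam k) := by
  have hm : Measurable (fun x : Fin l → ℝ => A *ᵥ x) :=
    (Continuous.matrix_mulVec continuous_const continuous_id).measurable
  refine ⟨hm, ?_⟩
  rw [← charFun_eq_pi_iff]
  intro t
  have h2 : ∏ i, charFun (gaussianReal 0 1) (t i) = Complex.exp (-(∑ i, (t i)^2 : ℝ)/2) := by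
    simp_rw [charFun_gaussianReal, ← Complex.exp_sum]
    simp [Finset.sum_div, neg_div]
  rw [h2, Measure.map_map (by fun_prop) hm, charFun_apply, integral_map
    (by fun_prop) (by fun_prop)]
  have h3 := charFun_pi (μ := fun _ : Fin l => gaussianReal 0 1) (WithLp.toLp 2 (Aᵀ *ᵥ (fun i => t i)))
  rw [charFun_apply, integral_map (by fun_prop) (by fun_prop)] at h3
  have h4 : ∀ x : Fin l → ℝ, inner ℝ (WithLp.toLp 2 x) (WithLp.toLp 2 (Aᵀ *ᵥ (fun i => t i))) =
     inner ℝ (((WithLp.toLp 2) ∘ (fun x : Fin l → ℝ => A *ᵥ x)) x) t := by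
    intro x
    have e1 : (WithLp.toLp 2 (fun i => t i) : EuclideanSpace ℝ (Fin k)) = t := rfl
    rw [← e1, Function.comp, EuclideanSpace.inner_toLp_toLp, EuclideanSpace.inner_toLp_toLp]
    simp only [star_trivial]
    rw [Matrix.mulVec_transpose, Matrix.dotProduct_mulVec]
  simp_rw [h4] at h3
  rw [h3]
  simp_rw [charFun_gaussianReal, ← Complex.exp_sum]
  have h5 : ∑ i, ((Aᵀ *ᵥ (fun i => t i)) i)^2 = ∑ i, (t i)^2 := by
    have e : ∀ {r : ℕ} (v : Fin r → ℝ), ∑ i, v i ^ 2 = v ⬝ᵥ v := by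
      intro r v; simp [dotProduct, sq]
    rw [e, e (fun i => t i), Matrix.dotProduct_mulVec, Matrix.vecMul_transpose, Matrix.mulVec_mulVec, hA, Matrix.one_mulVec]
  rw [← h5]
  simp [Finset.sum_div, neg_div]

lemma gam_density (k : ℕ) : ∀ (F : (Fin k → ℝ) → ENNReal) (_ : Measurable F),
    ∫⁻ x, F x ∂(gam k) = ∫⁻ x, (∏ i, gaussianPDF 0 1 (x i)) * F x := by
  induction k with
  | zero =>
    intro F hF
    simp only [Finset.univ_eq_empty, Finset.prod_empty, one_mul]
    rw [volume_pi]
    unfold gam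
    rw [Measure.pi_of_empty, Measure.pi_of_empty]
  | succ k ih =>
    intro F hF
    have hp1 := (measurePreserving_piFinSuccAbove (fun _ : Fin (k+1) => gaussianReal 0 1) 0).symm
    have hp2 := (volume_preserving_piFinSuccAbove (fun _ : Fin (k+1) => ℝ) 0).symm
    rw [← hp1.lintegral_comp hF, ← hp2.lintegral_comp (by fun_prop)]
    rw [lintegral_prod _ (by fun_prop), Measure.volume_eq_prod, lintegral_prod _ (by fun_prop)]
    have h := fun a : ℝ => ih (fun y => F ((MeasurableEquiv.piFinSuccAbove (fun _ : Fin (k+1) => ℝ) 0).symm (a, y))) (by fun_prop)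
    unfold gam at h
    simp_rw [h]
    rw [gaussianReal_of_var_ne_zero 0 one_ne_zero]
    rw [lintegral_withDensity_eq_lintegral_mul _ (by fun_prop)]
    swap
    · exact Measurable.lintegral_prod_right' (f := fun z : ℝ × (Fin k → ℝ) => (∏ i, gaussianPDF 0 1 (z.2 i)) * F ((MeasurableEquiv.piFinSuccAbove (fun _ : Fin (k+1) => ℝ) 0).symm z)) (by fun_prop)
    refine lintegral_congr fun a => ?_
    simp only [Pi.mul_apply]
    rw [← lintegral_const_mul _ (by fun_prop)]
    refine lintegral_congr fun y => ?_
    rw [Fin.prod_univ_succ, ← mul_assoc]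
    simp [MeasurableEquiv.piFinSuccAbove]

/-- `J a = ∫ r^{a-1} e^{-r²/2}`. -/
def J (a : ℕ) : ℝ := ∫ (y : ℝ) in Set.Ioi (0:ℝ), y ^ (a - 1) * Real.exp (-y^2/2)

lemma J_integrable (a : ℕ) :
    IntegrableOn (fun y : ℝ => y ^ a * Real.exp (-y^2/2)) (Set.Ioi 0) := by
  have h := integrableOn_rpow_mul_exp_neg_mul_rpow (s := (a:ℝ)) (p := 2) (b := 1/2)
    (by have : (0:ℝ) ≤ a := by positivity
        linarith) (by norm_num) (by norm_num)
  refine h.congr_fun (fun y hy => ?_) measurableSet_Ioi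
  simp only [Real.rpow_natCast, Real.rpow_two]
  ring_nf

lemma J_eq (a : ℕ) (ha : 1 ≤ a) : J a = 2 ^ ((a:ℝ)/2) / 2 * Real.Gamma ((a:ℝ)/2) := by
  have h := integral_rpow_mul_exp_neg_mul_rpow (q := (a:ℝ) - 1) (p := 2) (b := 1/2)
    (by norm_num) (by have : (1:ℝ) ≤ a := by exact_mod_cast ha
                      linarith) (by norm_num)
  have e : J a = ∫ x in Set.Ioi (0:ℝ), x ^ ((a:ℝ)-1) * Real.exp (-(1/2) * x ^ (2:ℝ)) := by
    refine setIntegral_congr_fun measurableSet_Ioi (fun y hy => ?_)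
    have : ((a:ℝ) - 1) = ((a - 1 : ℕ) : ℝ) := by rw [Nat.cast_sub ha]; simp
    simp only [this, Real.rpow_natCast, Real.rpow_two]
    ring_nf
  rw [e, h]
  have : (1/2:ℝ) ^ (-((a:ℝ) - 1 + 1)/2) = 2 ^ ((a:ℝ)/2) := by
    rw [one_div, Real.inv_rpow (by norm_num), ← Real.rpow_neg (by norm_num)]
    congr 1; ring
  rw [this]; ring_nf

lemma J_pos (a : ℕ) (ha : 1 ≤ a) : 0 < J a := by
  rw [J_eq a ha]
  have : (0:ℝ) < a := by exact_mod_cast ha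
  have := Real.Gamma_pos_of_pos (half_pos this)
  positivity

lemma norm2_meas {k : ℕ} : Measurable (norm2 : (Fin k → ℝ) → ℝ) := by
  unfold norm2; fun_prop

def Jf (k : ℕ) (f : ℝ → ℝ) : ℝ :=
  ∫ y in Set.Ioi (0:ℝ), y ^ (k-1) * (Real.exp (-y^2/2) * f y)

lemma radial_aux (k : ℕ) (hk : 1 ≤ k) : ∃ K : ℝ, 0 ≤ K ∧ ∀ (f : ℝ → ℝ) (_ : Measurable f) (_ : ∀ r, 0 ≤ r → 0 ≤ f r)
    (_ : IntegrableOn (fun y : ℝ => y ^ (k-1) * (Real.exp (-y^2/2) * f y)) (Set.Ioi 0)),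
    ∫⁻ x, ENNReal.ofReal (f (norm2 x)) ∂(gam k) =
      ENNReal.ofReal ((Jf k f) * K) := by
  have : Nontrivial (EuclideanSpace ℝ (Fin k)) := by
    have : Nonempty (Fin k) := ⟨⟨0, hk⟩⟩
    infer_instance
  set c : ℝ := ((√(2 * Real.pi))⁻¹)^k with hc
  refine ⟨c * ((k:ℝ) * (volume.real (Metric.ball (0 : EuclideanSpace ℝ (Fin k)) 1))), by positivity, ?_⟩
  intro f hf hf0 hint
  have hnm : Measurable (norm2 : (Fin k → ℝ) → ℝ) := norm2_meas
  rw [gam_density k _ (by fun_prop)]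
  have h1 : ∀ x : Fin k → ℝ, (∏ i, gaussianPDF 0 1 (x i)) * ENNReal.ofReal (f (norm2 x)) =
      ENNReal.ofReal (c * (Real.exp (-‖(WithLp.toLp 2 x : EuclideanSpace ℝ (Fin k))‖^2/2)
        * f ‖(WithLp.toLp 2 x : EuclideanSpace ℝ (Fin k))‖)) := by
    intro x
    have e : ‖(WithLp.toLp 2 x : EuclideanSpace ℝ (Fin k))‖ = norm2 x := by
      rw [EuclideanSpace.norm_eq]; simp [norm2]
    rw [e]
    simp only [gaussianPDF]
    rw [← ENNReal.ofReal_prod_of_nonneg (fun i _ => gaussianPDFReal_nonneg _ _ _),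
      ← ENNReal.ofReal_mul (Finset.prod_nonneg (fun i _ => gaussianPDFReal_nonneg _ _ _)), ← mul_assoc]
    congr 2
    simp only [gaussianPDFReal, Finset.prod_mul_distrib, ← Real.exp_sum]
    have : norm2 x ^ 2 = ∑ i, x i ^ 2 := by
      unfold norm2; rw [Real.sq_sqrt]; positivity
    rw [this, hc]
    simp [Finset.sum_div, neg_div]
  simp_rw [h1]
  rw [(PiLp.volume_preserving_toLp (Fin k)).lintegral_comp (f := fun x : EuclideanSpace ℝ (Fin k) => ENNReal.ofReal (c * (Real.exp (-‖x‖^2/2) * f ‖x‖))) (by fun_prop)]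
  have hI : Integrable (fun x : EuclideanSpace ℝ (Fin k) => (Real.exp (-‖x‖^2/2) * f ‖x‖)) := by
    rw [integrable_fun_norm_addHaar volume (f := fun r => Real.exp (-r^2/2) * f r)]
    simpa using hint
  rw [← ofReal_integral_eq_lintegral_ofReal (hI.const_mul c)
    (Filter.Eventually.of_forall fun x => by have := hf0 ‖x‖ (norm_nonneg _); simp only [Pi.zero_apply]; positivity)]
  rw [integral_const_mul, integral_fun_norm_addHaar volume (fun r => Real.exp (-r^2/2) * f r)]
  simp only [finrank_euclideanSpace, Fintype.card_fin, nsmul_eq_mul, smul_eq_mul]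
  congr 1
  unfold Jf
  ring

lemma radial (k : ℕ) (hk : 1 ≤ k) (f : ℝ → ℝ) (hf : Measurable f) (hf0 : ∀ r, 0 ≤ r → 0 ≤ f r)
    (hint : IntegrableOn (fun y : ℝ => y ^ (k-1) * (Real.exp (-y^2/2) * f y)) (Set.Ioi 0)) :
    ∫⁻ x, ENNReal.ofReal (f (norm2 x)) ∂(gam k) =
      ENNReal.ofReal ((Jf k f) / J k) := by
  obtain ⟨K, hK, h⟩ := radial_aux k hk
  have h1 := h (fun _ => 1) (by fun_prop) (by simp) (by simpa using J_integrable (k-1))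
  have hJ : Jf k (fun _ => 1) = J k := by simp [Jf, J]
  rw [hJ] at h1
  simp only [ENNReal.ofReal_one, lintegral_one, measure_univ] at h1
  have h2 : J k * K = 1 := by
    have := congrArg ENNReal.toReal h1
    rw [ENNReal.toReal_ofReal (mul_nonneg (J_pos k hk).le hK)] at this
    simpa using this.symm
  rw [h f hf hf0 hint]
  have := J_pos k hk
  congr 1
  field_simp
  rw [mul_assoc, mul_comm K, h2, mul_one]

lemma moment_pos (k q : ℕ) (hk : 1 ≤ k) :
    ∫⁻ x, ENNReal.ofReal (norm2 x ^ q) ∂(gam k) = ENNReal.ofReal (J (k+q) / J k) := by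
  have e : ∀ y : ℝ, y ^ (k-1) * (Real.exp (-y^2/2) * y^q) = y ^ (k+q-1) * Real.exp (-y^2/2) := by
    intro y
    rw [show k + q - 1 = (k-1) + q by omega, pow_add]; ring
  rw [radial k hk (fun r => r^q) (by fun_prop) (fun r hr => by positivity)]
  · unfold Jf; simp_rw [e]; rfl
  · simp_rw [e]; exact J_integrable _

lemma moment_neg (q : ℕ) :
    ∫⁻ x, ENNReal.ofReal ((norm2 x ^ q)⁻¹) ∂(gam (q+1)) = ENNReal.ofReal (J 1 / J (q+1)) := by
  have e : Set.EqOn (fun y : ℝ => y ^ (q+1-1) * (Real.exp (-y^2/2) * (y^q)⁻¹))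
     (fun y => y ^ 0 * Real.exp (-y^2/2)) (Set.Ioi 0) := by
    intro y hy
    have : y ≠ 0 := ne_of_gt hy
    simp; field_simp
  rw [radial (q+1) (by omega) (fun r => (r^q)⁻¹) (by fun_prop) (fun r hr => by positivity)]
  · unfold Jf; rw [setIntegral_congr_fun measurableSet_Ioi e]; rfl
  · rw [integrableOn_congr_fun e measurableSet_Ioi]; exact J_integrable _

lemma J_add_two (a : ℕ) (ha : 1 ≤ a) : J (a+2) = a * J a := by
  have h0 : (0:ℝ) < a := by exact_mod_cast ha
  rw [J_eq _ ha, J_eq _ (by omega)]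
  push_cast
  rw [show ((a:ℝ)+2)/2 = (a:ℝ)/2 + 1 by ring, Real.Gamma_add_one (by positivity),
    Real.rpow_add_one (by norm_num)]
  ring

lemma J_one : J 1 = √(Real.pi / 2) := by
  rw [J_eq 1 le_rfl]
  simp only [Nat.cast_one]
  rw [Real.Gamma_one_half_eq, ← Real.sqrt_eq_rpow, Real.sqrt_div Real.pi_pos.le]
  have : √(2:ℝ) * √2 = 2 := Real.mul_self_sqrt (by norm_num)
  field_simp
  nlinarith

lemma J_two : J 2 = 1 := by
  rw [J_eq 2 (by norm_num)]; simp

lemma J_step (a : ℕ) (ha : 1 ≤ a) : J (a+1) ≤ √a * J a := by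
  have h0 : (0:ℝ) < a := by exact_mod_cast ha
  have hG := Real.Gamma_pos_of_pos (half_pos h0)
  have h := Real.Gamma_mul_add_mul_le_rpow_Gamma_mul_rpow_Gamma (s := (a:ℝ)/2) (t := (a:ℝ)/2+1)
    (a := 1/2) (b := 1/2) (by positivity) (by positivity) (by norm_num) (by norm_num) (by norm_num)
  rw [← Real.sqrt_eq_rpow, ← Real.sqrt_eq_rpow, ← Real.sqrt_mul hG.le, Real.Gamma_add_one (by positivity),
    show Real.Gamma ((a:ℝ)/2) * ((a:ℝ)/2 * Real.Gamma ((a:ℝ)/2)) = (a:ℝ)/2 * (Real.Gamma ((a:ℝ)/2))^2 by ring,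
    Real.sqrt_mul (by positivity), Real.sqrt_sq hG.le, show (1/2 * ((a:ℝ)/2) + 1/2*((a:ℝ)/2+1)) = ((a:ℝ)+1)/2 by ring,
    Real.sqrt_div h0.le] at h
  rw [J_eq _ ha, J_eq _ (by omega)]
  push_cast
  rw [show ((a:ℝ)+1)/2 = (a:ℝ)/2 + 1/2 by ring, Real.rpow_add (by norm_num), ← Real.sqrt_eq_rpow]
  rw [show ((a:ℝ)+1)/2 = (a:ℝ)/2 + 1/2 by ring] at h
  have h2 : (0:ℝ) < 2 ^ ((a:ℝ)/2) := by positivity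
  have h3 : (0:ℝ) < √2 := by positivity
  calc _ ≤ 2 ^ ((a:ℝ)/2) * √2 / 2 * (√a / √2 * Real.Gamma ((a:ℝ)/2)) := by gcongr
    _ = _ := by field_simp

lemma J_mul (a : ℕ) : J (a+1) * J (a+2) = √(Real.pi/2) * (a.factorial : ℝ) := by
  induction a with
  | zero => simp [J_one, J_two]
  | succ a ih =>
    rw [show a + 1 + 2 = (a + 1) + 2 by rfl, J_add_two (a+1) (by omega), Nat.factorial_succ]
    push_cast
    push_cast at ih
    linear_combination ((a:ℝ)+1) * ih

lemma J_ratio (m q N : ℕ) (hm : 1 ≤ m) (hN : m + q ≤ N) : J (m+q) ≤ √N ^ q * J m := by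
  induction q with
  | zero => simp
  | succ q ih =>
    have h1 := J_step (m+q) (by omega)
    have h2 := ih (by omega)
    have h3 : √((m+q:ℕ):ℝ) ≤ √N := Real.sqrt_le_sqrt (by exact_mod_cast (by omega))
    have h4 := J_pos (m+q) (by omega)
    calc J (m+(q+1)) ≤ √((m+q:ℕ):ℝ) * J (m+q) := h1
      _ ≤ √N * (√N ^ q * J m) := by gcongr
      _ = _ := by ring

lemma J_sq (q : ℕ) (hq : 1 ≤ q) : J 1 ^ 2 ≤ (Real.exp 1 / q) ^ q * J (q+1) ^ 2 := by
  have h0 : (0:ℝ) < q := by exact_mod_cast hq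
  have h1 : (1:ℝ) ≤ q := by exact_mod_cast hq
  have hJ := J_pos (q+1) (by omega)
  have hs := J_step (q+1) (by omega)
  have hm := J_mul q
  have hst := Stirling.le_factorial_stirling q
  have hx : (0:ℝ) < (q / Real.exp 1) ^ q := by positivity
  have e1 : (Real.exp 1 / q) ^ q = ((q / Real.exp 1) ^ q)⁻¹ := by
    rw [← inv_pow, inv_div]
  rw [e1, J_one, Real.sq_sqrt (by positivity), inv_mul_eq_div, le_div_iff₀ hx]
  set X := ((q:ℝ) / Real.exp 1) ^ q
  have h2 : √(Real.pi/2) * (√(2 * Real.pi * q) * X) ≤ √((q+1:ℕ):ℝ) * J (q+1)^2 := by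
    calc _ ≤ √(Real.pi/2) * (q.factorial : ℝ) := by gcongr
      _ = J (q+1) * J (q+2) := hm.symm
      _ ≤ J (q+1) * (√((q+1:ℕ):ℝ) * J (q+1)) := by gcongr
      _ = _ := by ring
  rw [← mul_assoc, ← Real.sqrt_mul (by positivity), show Real.pi/2*(2*Real.pi*q) = q * Real.pi^2 by ring,
    Real.sqrt_mul h0.le, Real.sqrt_sq Real.pi_pos.le] at h2
  have h3 : √((q+1:ℕ):ℝ) ≤ 2 * √q := by
    rw [show 2 * √(q:ℝ) = √(4 * q) by rw [Real.sqrt_mul (by norm_num), show (4:ℝ) = 2^2 by norm_num, Real.sqrt_sq (by norm_num)]]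
    apply Real.sqrt_le_sqrt; push_cast; linarith
  have h4 : 0 < √(q:ℝ) := by positivity
  have h5 : √(q:ℝ) * (Real.pi * X) ≤ √(q:ℝ) * (2 * J (q+1)^2) := by
    calc _ ≤ √((q+1:ℕ):ℝ) * J (q+1)^2 := by linarith
      _ ≤ 2 * √q * J (q+1)^2 := by gcongr
      _ = _ := by ring
  have := le_of_mul_le_mul_left h5 h4
  linarith

lemma const_bound (m q : ℕ) (hm : 1 ≤ m) (hq : 1 ≤ q) :
    J (m+q) / J m * (J 1 / J (q+1)) ≤ (Real.exp 1 * √((m+q:ℕ):ℝ) / q) ^ q * (J (1+q) / J 1) := by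
  have h0 : (0:ℝ) < q := by exact_mod_cast hq
  have a1 := J_pos m hm
  have a2 := J_pos 1 le_rfl
  have a3 := J_pos (q+1) (by omega)
  have h1 := J_ratio m q (m+q) hm le_rfl
  have h2 := J_sq q hq
  rw [add_comm 1 q]
  have h3 : J (m+q) / J m ≤ √((m+q:ℕ):ℝ)^q := by rwa [div_le_iff₀ a1]
  have h4 : J 1 / J (q+1) ≤ (Real.exp 1 / q)^q * (J (q+1) / J 1) := by
    rw [← mul_div_assoc, div_le_div_iff₀ a3 a2]; nlinarith
  calc _ ≤ √((m+q:ℕ):ℝ)^q * ((Real.exp 1 / q)^q * (J (q+1) / J 1)) := by gcongr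
    _ = _ := by rw [← mul_assoc, ← mul_pow]; ring

lemma row_mp {m : ℕ} (u : Fin m → ℝ) (hu : u ⬝ᵥ u = 1) :
    MeasurePreserving (fun p : ℝ × (Fin m → ℝ) => fun j => p.2 j + (p.1 - u ⬝ᵥ p.2) * u j)
      ((gaussianReal 0 1).prod (gam m)) (gam m) := by
  have hp1 := (measurePreserving_piFinSuccAbove (fun _ : Fin (m+1) => gaussianReal 0 1) 0).symm
  let A : Matrix (Fin m) (Fin (m+1)) ℝ :=
    Matrix.of fun j => Fin.cons (u j) (fun i => (1 : Matrix (Fin m) (Fin m) ℝ) j i - u j * u i)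
  have hA : A * Aᵀ = 1 := by
    ext i j
    rw [Matrix.mul_apply, Fin.sum_univ_succ]
    simp only [A, Matrix.transpose_apply, Matrix.of_apply, Fin.cons_zero, Fin.cons_succ]
    have : ∀ x, ((1 : Matrix (Fin m) (Fin m) ℝ) i x - u i * u x) * ((1 : Matrix (Fin m) (Fin m) ℝ) j x - u j * u x)
      = (1 : Matrix (Fin m) (Fin m) ℝ) i x * (1 : Matrix (Fin m) (Fin m) ℝ) x j
        - u j * ((1 : Matrix (Fin m) (Fin m) ℝ) i x * u x)
        - u i * ((1 : Matrix (Fin m) (Fin m) ℝ) j x * u x) + u i * u j * (u x * u x) := by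
      intro x
      rw [show (1 : Matrix (Fin m) (Fin m) ℝ) x j = (1 : Matrix (Fin m) (Fin m) ℝ) j x by
        simp [Matrix.one_apply, eq_comm]]
      ring
    simp_rw [this, Finset.sum_add_distrib, Finset.sum_sub_distrib, ← Finset.mul_sum]
    rw [← Matrix.mul_apply, Matrix.one_mul]
    have h1 : ∑ x, u x * u x = 1 := hu
    rw [h1]
    simp [Matrix.one_apply]
    ring
  convert (law A hA).comp hp1 using 1
  · funext p j
    simp only [Function.comp, Matrix.mulVec, dotProduct, A]
    rw [Fin.sum_univ_succ]
    simp [MeasurableEquiv.piFinSuccAbove, sub_mul, Matrix.one_apply, Finset.sum_sub_distrib, Finset.sum_mul]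
    simp only [mul_assoc, mul_comm, mul_left_comm]
    ring

lemma mat_mp {n m : ℕ} (u : Fin m → ℝ) (hu : u ⬝ᵥ u = 1) :
    MeasurePreserving (fun p : (Fin n → ℝ) × (Fin n → Fin m → ℝ) =>
        fun i j => p.2 i j + (p.1 i - u ⬝ᵥ p.2 i) * u j)
      ((gam n).prod (stdGaussianMat n m)) (stdGaussianMat n m) := by
  have h1 := (measurePreserving_arrowProdEquivProdArrow ℝ (Fin m → ℝ) (Fin n)
    (fun _ => gaussianReal 0 1) (fun _ => gam m)).symm
  have h2 := measurePreserving_pi (fun _ : Fin n => (gaussianReal 0 1).prod (gam m)) (fun _ => gam m)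
    (fun _ => row_mp u hu)
  exact h2.comp h1

lemma exists_A {n m k : ℕ} (B : Matrix (Fin n) (Fin m) ℝ) (u : Fin m → ℝ) (hu : u ≠ 0)
    (hB : B *ᵥ u = 0) (hk : k + m = n + 1) :
    ∃ A : Matrix (Fin k) (Fin n) ℝ, A * Aᵀ = 1 ∧ A * B = 0 := by
  let f : (Fin m → ℝ) →ₗ[ℝ] EuclideanSpace ℝ (Fin n) :=
    (WithLp.linearEquiv 2 ℝ (Fin n → ℝ)).symm.toLinearMap ∘ₗ B.mulVecLin
  have hf : ∀ x, f x = WithLp.toLp 2 (B *ᵥ x) := fun x => rfl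
  have hker : 0 < Module.finrank ℝ (LinearMap.ker f) := by
    have : Nontrivial (LinearMap.ker f) := by
      refine ⟨⟨⟨u, ?_⟩, 0, ?_⟩⟩
      · rw [LinearMap.mem_ker, hf, hB]; rfl
      · intro h; exact hu (congrArg Subtype.val h)
    exact Module.finrank_pos
  have hrk := LinearMap.finrank_range_add_finrank_ker f
  have horth := Submodule.finrank_add_finrank_orthogonal (LinearMap.range f)
  simp at hrk horth
  let b := stdOrthonormalBasis ℝ (LinearMap.range f)ᗮ
  have hle : k ≤ Module.finrank ℝ (LinearMap.range f)ᗮ := by omega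
  let w : Fin k → EuclideanSpace ℝ (Fin n) := fun i => (b (Fin.castLE hle i)).1
  refine ⟨Matrix.of fun i j => w i j, ?_, ?_⟩
  · ext i j
    have hin : inner ℝ (w i) (w j) = if i = j then 1 else 0 := by
      have := (orthonormal_iff_ite.mp b.orthonormal) (Fin.castLE hle i) (Fin.castLE hle j)
      rw [Submodule.coe_inner] at this
      rw [this]
      simp
    rw [Matrix.mul_apply, Matrix.one_apply, ← hin, PiLp.inner_apply]
    exact Finset.sum_congr rfl fun l _ => mul_comm _ _
  · ext i j
    have hmem : f (Pi.single j 1) ∈ LinearMap.range f := ⟨_, rfl⟩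
    have h := (Submodule.mem_orthogonal' _ _).1 (b (Fin.castLE hle i)).2 _ hmem
    rw [hf, Matrix.mulVec_single_one, PiLp.inner_apply] at h
    rw [Matrix.mul_apply, Matrix.zero_apply, ← h]
    exact Finset.sum_congr rfl fun l _ => mul_comm _ _

lemma norm2_sq {k : ℕ} (v : Fin k → ℝ) : norm2 v ^ 2 = v ⬝ᵥ v := by
  unfold norm2; rw [Real.sq_sqrt (by positivity)]; simp [dotProduct, sq]

lemma norm2_nonneg {k : ℕ} (v : Fin k → ℝ) : 0 ≤ norm2 v := Real.sqrt_nonneg _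

lemma alg {n m k : ℕ} (G B : Matrix (Fin n) (Fin m) ℝ) (u : Fin m → ℝ) (a : Fin n → ℝ)
    (A : Matrix (Fin k) (Fin n) ℝ) (hA : A * Aᵀ = 1) (hAB : A * B = 0)
    (hG : G = Matrix.vecMulVec a u + B) :
    norm2 ((G * (Gᵀ * G)⁻¹) *ᵥ u) * norm2 (A *ᵥ a) ≤ 1 := by
  by_cases hdet : IsUnit (Gᵀ * G).det
  swap
  · rw [Matrix.nonsing_inv_apply_not_isUnit _ hdet]
    simp [norm2]
  set x := (Gᵀ * G)⁻¹ *ᵥ u with hx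
  set y := (G * (Gᵀ * G)⁻¹) *ᵥ u with hy
  have hyx : y = G *ᵥ x := by rw [hx, hy, Matrix.mulVec_mulVec]
  have hGy : Gᵀ *ᵥ y = u := by
    rw [hy, Matrix.mulVec_mulVec, ← Matrix.mul_assoc, Matrix.mul_nonsing_inv _ hdet, Matrix.one_mulVec]
  have hyy : y ⬝ᵥ y = u ⬝ᵥ x := by
    nth_rw 2 [hyx]
    rw [Matrix.dotProduct_mulVec, ← Matrix.mulVec_transpose, hGy]
  have hAy : A *ᵥ y = (u ⬝ᵥ x) • (A *ᵥ a) := by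
    rw [hyx, hG, Matrix.add_mulVec, Matrix.mulVec_add, Matrix.mulVec_mulVec _ A B, hAB,
      Matrix.zero_mulVec, add_zero, Matrix.vecMulVec_mulVec]
    simp [Matrix.mulVec_smul]
  have hB : (A *ᵥ y) ⬝ᵥ (A *ᵥ y) ≤ y ⬝ᵥ y := by
    have h0 : 0 ≤ (y - Aᵀ *ᵥ (A *ᵥ y)) ⬝ᵥ (y - Aᵀ *ᵥ (A *ᵥ y)) := by
      rw [← norm2_sq]; positivity
    have h1 : y ⬝ᵥ (Aᵀ *ᵥ (A *ᵥ y)) = (A *ᵥ y) ⬝ᵥ (A *ᵥ y) := by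
      rw [Matrix.dotProduct_mulVec, Matrix.vecMul_transpose]
    have h2 : (Aᵀ *ᵥ (A *ᵥ y)) ⬝ᵥ (Aᵀ *ᵥ (A *ᵥ y)) = (A *ᵥ y) ⬝ᵥ (A *ᵥ y) := by
      rw [Matrix.dotProduct_mulVec, Matrix.vecMul_transpose, Matrix.mulVec_mulVec, hA, Matrix.one_mulVec]
    rw [sub_dotProduct, dotProduct_sub, dotProduct_sub, h1, h2, dotProduct_comm (Aᵀ *ᵥ (A *ᵥ y)) y, h1] at h0
    linarith
  rw [hAy, smul_dotProduct, dotProduct_smul, ← norm2_sq, ← norm2_sq, ← hyy, ← norm2_sq] at hB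
  simp only [smul_eq_mul] at hB
  have n1 := norm2_nonneg y
  have n2 := norm2_nonneg (A *ᵥ a)
  rcases n1.eq_or_lt with h | h
  · rw [← h]; simp
  · have h2 : 0 < norm2 y ^ 2 := by positivity
    have : (norm2 y * norm2 (A *ᵥ a)) ^ 2 ≤ 1 := by
      have := le_of_mul_le_mul_left (a := norm2 y ^ 2) (b := norm2 y ^ 2 * norm2 (A *ᵥ a)^2) (c := 1) (by linarith) h2
      rw [mul_pow]; exact this
    nlinarith [mul_nonneg n1 n2]

instance (n m : ℕ) : IsProbabilityMeasure (stdGaussianMat n m) := by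
  unfold stdGaussianMat; infer_instance

/-- The transposed pseudoinverse applied to `u`. -/
def T {n m : ℕ} (g : Fin n → Fin m → ℝ) (u : Fin m → ℝ) : Fin n → ℝ :=
  (Matrix.of g * ((Matrix.of g)ᵀ * Matrix.of g)⁻¹) *ᵥ u

lemma T_meas {n m : ℕ} :
    Measurable (fun p : (Fin n → Fin m → ℝ) × (Fin m → ℝ) => T p.1 p.2) := by
  have e : (fun p : (Fin n → Fin m → ℝ) × (Fin m → ℝ) => T p.1 p.2) =
    fun p => (((Matrix.of p.1)ᵀ * Matrix.of p.1).det)⁻¹ •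
      ((Matrix.of p.1 * ((Matrix.of p.1)ᵀ * Matrix.of p.1).adjugate) *ᵥ p.2) := by
    funext p
    rw [T, Matrix.inv_def, Ring.inverse_eq_inv', Matrix.mul_smul, Matrix.smul_mulVec]
  rw [e]
  have c0 : Continuous (fun p : (Fin n → Fin m → ℝ) × (Fin m → ℝ) => Matrix.of p.1) :=
    continuous_fst
  have c1 := (c0.matrix_transpose.matrix_mul c0)
  exact Measurable.smul c1.matrix_det.measurable.inv
    ((c0.matrix_mul c1.matrix_adjugate).matrix_mulVec continuous_snd).measurable

lemma T_pow_meas {n m q : ℕ} :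
    Measurable (fun p : (Fin n → Fin m → ℝ) × (Fin m → ℝ) =>
      ENNReal.ofReal (norm2 (T p.1 p.2) ^ q)) :=
  ((norm2_meas.comp T_meas).pow_const q).ennreal_ofReal

lemma T_pow_meas_left {n m q : ℕ} (u : Fin m → ℝ) :
    Measurable (fun g : Fin n → Fin m → ℝ => ENNReal.ofReal (norm2 (T g u) ^ q)) := by
  have h : Measurable (fun g : Fin n → Fin m → ℝ => (g, u)) := measurable_prodMk_right
  have h2 := (T_pow_meas (q := q)).comp h
  simp only [Function.comp_def] at h2
  exact h2

lemma norm2_smul {k : ℕ} (c : ℝ) (hc : 0 ≤ c) (v : Fin k → ℝ) : norm2 (c • v) = c * norm2 v := by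
  unfold norm2
  simp only [Pi.smul_apply, smul_eq_mul, mul_pow, ← Finset.mul_sum]
  rw [Real.sqrt_mul (by positivity), Real.sqrt_sq hc]

lemma norm2_eq_zero {k : ℕ} {v : Fin k → ℝ} (h : norm2 v = 0) : v = 0 := by
  have := norm2_sq v
  rw [h] at this
  exact dotProduct_self_eq_zero.1 (by linarith)

lemma unit_exists {k : ℕ} (v : Fin k → ℝ) (hv : norm2 v ≠ 0) :
    ∃ w : Fin k → ℝ, w ⬝ᵥ w = 1 ∧ v = norm2 v • w := by
  refine ⟨(norm2 v)⁻¹ • v, ?_, ?_⟩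
  · rw [smul_dotProduct, dotProduct_smul, ← norm2_sq]
    simp only [smul_eq_mul]; field_simp
  · rw [smul_smul, mul_inv_cancel₀ hv, one_smul]

lemma fixed_unit {m q : ℕ} (u : Fin m → ℝ) (hu : u ⬝ᵥ u = 1) :
    ∫⁻ g, ENNReal.ofReal (norm2 (T g u) ^ q) ∂(stdGaussianMat (m+q) m) ≤
      ENNReal.ofReal (J 1 / J (q+1)) := by
  have hFm : Measurable (fun g : Fin (m+q) → Fin m → ℝ => ENNReal.ofReal (norm2 (T g u) ^ q)) :=
    T_pow_meas_left u
  have hmp := mat_mp (n := m+q) u hu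
  rw [← hmp.lintegral_comp hFm, lintegral_prod_symm' _ (by
    have := hFm.comp hmp.measurable
    simp only [Function.comp_def] at this
    exact this)]
  have key : ∀ H : Fin (m+q) → Fin m → ℝ,
      ∫⁻ a, ENNReal.ofReal (norm2 (T (fun i j => H i j + (a i - u ⬝ᵥ H i) * u j) u) ^ q) ∂(gam (m+q))
        ≤ ENNReal.ofReal (J 1 / J (q+1)) := by
    intro H
    let B : Matrix (Fin (m+q)) (Fin m) ℝ := Matrix.of fun i j => H i j - (u ⬝ᵥ H i) * u j
    have hu0 : u ≠ 0 := by rintro rfl; simp at hu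
    have hB : B *ᵥ u = 0 := by
      funext i
      have h1 : ∑ x, u x * u x = 1 := hu
      simp only [B, Matrix.mulVec, dotProduct, Matrix.of_apply, sub_mul, Finset.sum_sub_distrib,
        Pi.zero_apply, mul_assoc, ← Finset.mul_sum, h1, mul_one]
      simp [mul_comm]
    obtain ⟨A, hA, hAB⟩ := exists_A (k := q+1) B u hu0 hB (by omega)
    rw [← moment_neg q]
    have hl := law A hA
    have hnm : Measurable (norm2 : (Fin (q+1) → ℝ) → ℝ) := norm2_meas
    rw [← hl.lintegral_comp (f := fun x => ENNReal.ofReal ((norm2 x ^ q)⁻¹)) (by fun_prop)]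
    have hae : ∀ᵐ x ∂(gam (q+1)), x ≠ 0 := by
      have : NullSingletonClass (gaussianReal 0 1) := nullSingletonClass_gaussianReal one_ne_zero
      have : NullSingletonClass (gam (q+1)) := Measure.pi_nullSingletonClass 0
      exact Measure.ae_ne (gam (q+1)) 0
    have hae2 := hl.quasiMeasurePreserving.ae hae
    refine lintegral_mono_ae ?_
    filter_upwards [hae2] with a ha
    refine ENNReal.ofReal_le_ofReal ?_
    have hpos : 0 < norm2 (A *ᵥ a) :=
      lt_of_le_of_ne (norm2_nonneg _) (fun h => ha (norm2_eq_zero h.symm))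
    have hal := alg (Matrix.of fun i j => H i j + (a i - u ⬝ᵥ H i) * u j) B u a A hA hAB (by
      ext i j; simp [B, Matrix.vecMulVec_apply]; ring)
    rw [← inv_pow]
    refine pow_le_pow_left₀ (norm2_nonneg _) ?_ q
    rw [inv_eq_one_div, le_div_iff₀ hpos]
    exact hal
  calc _ ≤ ∫⁻ H, ENNReal.ofReal (J 1 / J (q+1)) ∂(stdGaussianMat (m+q) m) := lintegral_mono key
    _ = _ := by simp

lemma fixed {m q : ℕ} (hq : 1 ≤ q) (u : Fin m → ℝ) :
    ∫⁻ g, ENNReal.ofReal (norm2 (T g u) ^ q) ∂(stdGaussianMat (m+q) m) ≤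
      ENNReal.ofReal (norm2 u ^ q) * ENNReal.ofReal (J 1 / J (q+1)) := by
  by_cases h : norm2 u = 0
  · have hu := norm2_eq_zero h
    subst hu
    have : ∀ g : Fin (m+q) → Fin m → ℝ, norm2 (T g 0) = 0 := by
      intro g; simp [T, norm2]
    simp [this, show q ≠ 0 by omega]
  · obtain ⟨w, hw, huw⟩ := unit_exists u h
    have e : ∀ g : Fin (m+q) → Fin m → ℝ, ENNReal.ofReal (norm2 (T g u) ^ q) =
        ENNReal.ofReal (norm2 u ^ q) * ENNReal.ofReal (norm2 (T g w) ^ q) := by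
      intro g
      have h0 := norm2_nonneg u
      have : T g u = norm2 u • T g w := by
        conv_lhs => rw [huw]
        rw [T, Matrix.mulVec_smul]; rfl
      rw [this, norm2_smul _ h0, mul_pow, ENNReal.ofReal_mul (by positivity)]
    simp_rw [e]
    rw [lintegral_const_mul' _ _ ENNReal.ofReal_ne_top]
    gcongr
    exact fixed_unit w hw

lemma cs {k : ℕ} (w v : Fin k → ℝ) (hw : norm2 w = 1) : |w ⬝ᵥ v| ≤ norm2 v := by
  have h := Finset.sum_mul_sq_le_sq_mul_sq Finset.univ w v
  have h1 : ∑ i, w i ^ 2 = 1 := by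
    have := norm2_sq w
    rw [hw] at this
    simp [dotProduct, ← sq] at this
    exact this.symm
  rw [h1, one_mul] at h
  exact Real.abs_le_sqrt h

lemma lin_moment {m q : ℕ} (hq : 1 ≤ q) (a : Fin m → ℝ) :
    ∫⁻ u, ENNReal.ofReal (|a ⬝ᵥ u| ^ q) ∂(gam m) =
      ENNReal.ofReal (norm2 a ^ q) * ENNReal.ofReal (J (1+q) / J 1) := by
  by_cases h : norm2 a = 0
  · rw [norm2_eq_zero h]
    simp [show q ≠ 0 by omega, norm2]
  · obtain ⟨w, hw, haw⟩ := unit_exists a h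
    let A : Matrix (Fin 1) (Fin m) ℝ := Matrix.of fun _ => w
    have hA : A * Aᵀ = 1 := by
      ext i j
      have h1 : ∑ x, w x * w x = 1 := hw
      simp [A, Matrix.mul_apply, h1, Matrix.one_apply, Subsingleton.elim i j]
    have hnm : Measurable (norm2 : (Fin 1 → ℝ) → ℝ) := norm2_meas
    rw [← moment_pos 1 q le_rfl, ← (law A hA).lintegral_comp (by fun_prop),
      ← lintegral_const_mul' _ _ ENNReal.ofReal_ne_top]
    refine lintegral_congr fun u => ?_
    have h0 := norm2_nonneg a
    rw [← ENNReal.ofReal_mul (by positivity), ← mul_pow]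
    congr 2
    have : norm2 (A *ᵥ u) = |w ⬝ᵥ u| := by
      simp [norm2, A, Matrix.mulVec, Real.sqrt_sq_eq_abs]
    rw [this]
    conv_lhs => rw [haw]
    rw [smul_dotProduct, smul_eq_mul, abs_mul, abs_of_nonneg h0]

lemma lower {n m q : ℕ} (hq : 1 ≤ q) (g : Fin n → Fin m → ℝ) :
    ENNReal.ofReal (spec (pinv (Matrix.of g)) ^ q) * ENNReal.ofReal (J (1+q) / J 1) ≤
      ∫⁻ u, ENNReal.ofReal (norm2 (T g u) ^ q) ∂(gam m) := by
  set I := ∫⁻ u, ENNReal.ofReal (norm2 (T g u) ^ q) ∂(gam m) with hI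
  set c := J (1+q) / J 1 with hc
  have hcpos : 0 < c := div_pos (J_pos _ (by omega)) (J_pos _ le_rfl)
  have hq0 : q ≠ 0 := by omega
  have hT : ∀ w : Fin n → ℝ, norm2 w = 1 →
      ENNReal.ofReal (norm2 (pinv (Matrix.of g) *ᵥ w) ^ q) * ENNReal.ofReal c ≤ I := by
    intro w hw
    rw [hc, ← lin_moment hq]
    refine lintegral_mono fun u => ENNReal.ofReal_le_ofReal ?_
    refine pow_le_pow_left₀ (abs_nonneg _) ?_ q
    have e : (pinv (Matrix.of g) *ᵥ w) ⬝ᵥ u = w ⬝ᵥ T g u := by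
      have e1 : (Matrix.of g * ((Matrix.of g)ᵀ * Matrix.of g)⁻¹) = (pinv (Matrix.of g))ᵀ := by
        rw [pinv, Matrix.transpose_mul, Matrix.transpose_transpose, Matrix.transpose_nonsing_inv,
          Matrix.transpose_mul, Matrix.transpose_transpose]
      rw [T, e1, Matrix.dotProduct_mulVec, Matrix.vecMul_transpose]
    rw [e]
    exact cs w _ hw
  by_cases htop : I = ⊤
  · rw [htop]; exact le_top
  have hs : spec (pinv (Matrix.of g)) ≤ (I.toReal / c) ^ ((q:ℝ)⁻¹) := by
    refine Real.sSup_le ?_ (by positivity)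
    rintro x ⟨w, hw, rfl⟩
    have h := hT w hw
    have h0 := norm2_nonneg (pinv (Matrix.of g) *ᵥ w)
    rw [← ENNReal.ofReal_mul (by positivity), ENNReal.ofReal_le_iff_le_toReal htop,
      ← le_div_iff₀ hcpos] at h
    calc _ = ((norm2 (pinv (Matrix.of g) *ᵥ w)) ^ q) ^ ((q:ℝ)⁻¹) := (Real.pow_rpow_inv_natCast h0 hq0).symm
      _ ≤ _ := Real.rpow_le_rpow (by positivity) h (by positivity)
  have hs0 : 0 ≤ spec (pinv (Matrix.of g)) := by
    refine Real.sSup_nonneg ?_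
    rintro x ⟨w, hw, rfl⟩
    exact norm2_nonneg _
  have h2 : spec (pinv (Matrix.of g)) ^ q ≤ I.toReal / c := by
    calc _ ≤ ((I.toReal / c) ^ ((q:ℝ)⁻¹)) ^ q := pow_le_pow_left₀ hs0 hs q
      _ = _ := Real.rpow_inv_natCast_pow (by positivity) hq0
  rw [← ENNReal.ofReal_mul (by positivity), ENNReal.ofReal_le_iff_le_toReal htop,
    ← le_div_iff₀ hcpos]
  exact h2

lemma main_q (m q : ℕ) (hm : 1 ≤ m) (hq : 1 ≤ q) :
    ∫⁻ g, ENNReal.ofReal (spec (pinv (Matrix.of g)) ^ q) ∂(stdGaussianMat (m+q) m) ≤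
      ENNReal.ofReal ((Real.exp 1 * √((m+q:ℕ):ℝ) / q) ^ q) := by
  have hcpos : 0 < J (1+q) / J 1 := div_pos (J_pos _ (by omega)) (J_pos _ le_rfl)
  have hd : 0 ≤ J (m+q) / J m := (div_pos (J_pos _ (by omega)) (J_pos _ hm)).le
  have h : (∫⁻ g, ENNReal.ofReal (spec (pinv (Matrix.of g)) ^ q) ∂(stdGaussianMat (m+q) m))
      * ENNReal.ofReal (J (1+q) / J 1) ≤
      ENNReal.ofReal ((Real.exp 1 * √((m+q:ℕ):ℝ) / q) ^ q) * ENNReal.ofReal (J (1+q) / J 1) := by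
    calc _ = ∫⁻ g, ENNReal.ofReal (spec (pinv (Matrix.of g)) ^ q) * ENNReal.ofReal (J (1+q) / J 1)
            ∂(stdGaussianMat (m+q) m) := (lintegral_mul_const' _ _ ENNReal.ofReal_ne_top).symm
      _ ≤ ∫⁻ g, ∫⁻ u, ENNReal.ofReal (norm2 (T g u) ^ q) ∂(gam m) ∂(stdGaussianMat (m+q) m) :=
          lintegral_mono fun g => lower hq g
      _ = ∫⁻ u, ∫⁻ g, ENNReal.ofReal (norm2 (T g u) ^ q) ∂(stdGaussianMat (m+q) m) ∂(gam m) :=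
          lintegral_lintegral_swap T_pow_meas.aemeasurable
      _ ≤ ∫⁻ u, ENNReal.ofReal (norm2 u ^ q) * ENNReal.ofReal (J 1 / J (q+1)) ∂(gam m) :=
          lintegral_mono fun u => fixed hq u
      _ = ENNReal.ofReal (J (m+q) / J m) * ENNReal.ofReal (J 1 / J (q+1)) := by
          rw [lintegral_mul_const' _ _ ENNReal.ofReal_ne_top, moment_pos m q hm]
      _ ≤ _ := by
          rw [← ENNReal.ofReal_mul hd, ← ENNReal.ofReal_mul (by positivity)]
          exact ENNReal.ofReal_le_ofReal (const_bound m q hm hq)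
  exact (ENNReal.mul_le_mul_iff_left (by simpa using hcpos) ENNReal.ofReal_ne_top).1 h

lemma young (p q : ℕ) (hp : 1 ≤ p) (hpq : p ≤ q) (t : ℝ) (ht : 0 ≤ t) :
    t ^ p ≤ (p/q : ℝ) * t ^ q + (1 - p/q) := by
  have hq : (0:ℝ) < q := by exact_mod_cast (by omega : 0 < q)
  have h1 : (p/q : ℝ) ≤ 1 := by rw [div_le_one hq]; exact_mod_cast hpq
  have h := Real.geom_mean_le_arith_mean2_weighted (w₁ := (p/q:ℝ)) (w₂ := 1 - p/q) (p₁ := t^q) (p₂ := 1)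
    (by positivity) (by linarith) (by positivity) (by norm_num) (by ring)
  rw [Real.one_rpow, mul_one, mul_one, ← Real.rpow_natCast t q, ← Real.rpow_mul ht,
    mul_div_cancel₀ _ hq.ne', Real.rpow_natCast, Real.rpow_natCast] at h
  exact h

/-- Lemma B.4: for an `n × m` standard Gaussian matrix `G` with
`n ≥ m ≥ 2` and a positive integer `p` with `n > m + p − 1`,
`E‖G†‖^p ≤ (e√n/(n − m − p + 1))^p`. -/
theorem expected_pinv_norm_pow
    (n m p : ℕ) (hm : 2 ≤ m) (hnm : m ≤ n) (hp : 1 ≤ p) (hnp : m + p - 1 < n) :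
    (∫ g, spec (pinv (Matrix.of g)) ^ p ∂(stdGaussianMat n m)) ≤
      (Real.exp 1 * Real.sqrt n / ((n : ℝ) - (m : ℝ) - (p : ℝ) + 1)) ^ p := by
  obtain ⟨q, rfl⟩ := Nat.exists_eq_add_of_le hnm
  have hpq : p ≤ q := by omega
  have hq1 : 1 ≤ q := by omega
  have hq : (0:ℝ) < q := by exact_mod_cast hq1
  have hp1 : (1:ℝ) ≤ p := by exact_mod_cast hp
  have hpq' : (p:ℝ) ≤ q := by exact_mod_cast hpq
  have hn : (0:ℝ) < ((m+q:ℕ):ℝ) := by exact_mod_cast (by omega)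
  set R := Real.exp 1 * √((m+q:ℕ):ℝ) / q with hR
  have hRpos : 0 < R := by positivity
  have hmain := main_q m q (by omega) hq1
  rw [← hR] at hmain
  have hs0 : ∀ g : Fin (m+q) → Fin m → ℝ, 0 ≤ spec (pinv (Matrix.of g)) := by
    intro g
    refine Real.sSup_nonneg ?_
    rintro x ⟨w, hw, rfl⟩
    exact norm2_nonneg _
  have hle : R ^ p ≤ (Real.exp 1 * Real.sqrt ((m+q:ℕ):ℝ) / ((((m+q:ℕ):ℝ)) - (m : ℝ) - (p : ℝ) + 1)) ^ p := by
    refine pow_le_pow_left₀ hRpos.le ?_ p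
    rw [hR]
    refine div_le_div_of_nonneg_left (by positivity) ?_ ?_ <;> push_cast <;> linarith
  refine le_trans ?_ hle
  by_cases hint : Integrable (fun g => spec (pinv (Matrix.of g)) ^ p) (stdGaussianMat (m+q) m)
  swap
  · rw [integral_undef hint]; positivity
  rw [← ENNReal.ofReal_le_ofReal_iff (by positivity),
    ofReal_integral_eq_lintegral_ofReal hint (Filter.Eventually.of_forall fun g => pow_nonneg (hs0 g) p)]
  have h1 : (p/q : ℝ) ≤ 1 := by rw [div_le_one hq]; exact hpq'
  calc _ ≤ ∫⁻ g, (ENNReal.ofReal (R^p * (p/q) / R^q) * ENNReal.ofReal (spec (pinv (Matrix.of g)) ^ q)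
            + ENNReal.ofReal (R^p * (1 - p/q))) ∂(stdGaussianMat (m+q) m) := by
        refine lintegral_mono fun g => ?_
        have h0 := hs0 g
        rw [← ENNReal.ofReal_mul (by positivity), ← ENNReal.ofReal_add (by positivity)
          (mul_nonneg (by positivity) (by linarith))]
        refine ENNReal.ofReal_le_ofReal ?_
        have hy := young p q hp hpq (spec (pinv (Matrix.of g)) / R) (by positivity)
        rw [div_pow, div_pow, div_le_iff₀ (by positivity)] at hy
        refine hy.trans (le_of_eq ?_)
        ring
    _ = ENNReal.ofReal (R^p * (p/q) / R^q) * (∫⁻ g, ENNReal.ofReal (spec (pinv (Matrix.of g)) ^ q) ∂(stdGaussianMat (m+q) m))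
          + ENNReal.ofReal (R^p * (1 - p/q)) := by
        rw [lintegral_add_right _ measurable_const, lintegral_const_mul' _ _ ENNReal.ofReal_ne_top]
        simp
    _ ≤ ENNReal.ofReal (R^p * (p/q) / R^q) * ENNReal.ofReal (R^q) + ENNReal.ofReal (R^p * (1 - p/q)) := by
        gcongr
    _ = ENNReal.ofReal (R^p) := by
        rw [← ENNReal.ofReal_mul (by positivity), ← ENNReal.ofReal_add (by positivity)
          (mul_nonneg (by positivity) (by linarith))]
        congr 1
        field_simp
        ring

end Stmt13
end
end

section
/- In the linear regression setting with K auxiliary tasks weighted by λ_1,…,λ_K ≥ 0, the expectation over the training set of the weighted least-squares estimator equals w̄ := E_D[ŵ_D] = (1/(1 + Λ))·(w*_m + Σ_{k=1}^K λ_k w*_k), where Λ = Σ_{k=1}^K λ_k. Consequently, the bias term of the generalization error equals E_x[(x^T(w̄ − w*_m))²] = (Λ/(1+Λ))²·||Σ_x^{1/2}(w*_aux − w*_m)||² with w*_aux = (1/Λ)Σ_{k=1}^K λ_k w*_k (when Λ > 0). -/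
open MeasureTheory ProbabilityTheory Matrix

noncomputable section

namespace Stmt16

/-- The quadratic form `vᵀ Σ v`, which equals `‖Σ^{1/2} v‖²` for positive semidefinite `Σ`. -/
def quadForm {d : ℕ} (Sigx : Matrix (Fin d) (Fin d) ℝ) (v : Fin d → ℝ) : ℝ :=
  v ⬝ᵥ (Sigx *ᵥ v)

/-- `(XᵀX)⁻¹Xᵀ`, the OLS map. -/
def pinv {N d : ℕ} (X : Matrix (Fin N) (Fin d) ℝ) : Matrix (Fin d) (Fin N) ℝ :=
  (Xᵀ * X)⁻¹ * Xᵀ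

/-- Law of a vector of `n` i.i.d. centered Gaussians with variance `v`. -/
def gaussianVec (n : ℕ) (v : ℝ) : Measure (Fin n → ℝ) :=
  Measure.pi fun _ => gaussianReal 0 (Real.toNNReal v)

/-- Training sample space: (standard-Gaussian feature source, auxiliary noises, main noise). -/
abbrev Sample (N d K : ℕ) : Type :=
  (Fin N → Fin d → ℝ) × (Fin K → Fin N → ℝ) × (Fin N → ℝ)

/-- Joint law of the training data: all sources independent Gaussians. -/
def P (N d K : ℕ) (σm : ℝ) (σa : Fin K → ℝ) : Measure (Sample N d K) :=
  (Measure.pi fun _ : Fin N => gaussianVec d 1).prod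
    ((Measure.pi fun k : Fin K => gaussianVec N (σa k ^ 2)).prod
      (gaussianVec N (σm ^ 2)))

/-- Design matrix `X` whose rows are i.i.d. `N(0, A Aᵀ)`. -/
def Xmat {N d K : ℕ} (A : Matrix (Fin d) (Fin d) ℝ) (ω : Sample N d K) :
    Matrix (Fin N) (Fin d) ℝ :=
  Matrix.of ω.1 * Aᵀ

/-- Main-task labels `Y_m = X w*_m + ε_m`. -/
def Ym {N d K : ℕ} (A : Matrix (Fin d) (Fin d) ℝ) (wm : Fin d → ℝ) (ω : Sample N d K) :
    Fin N → ℝ :=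
  Xmat A ω *ᵥ wm + ω.2.2

/-- Auxiliary labels `Y_k = X w*_k + ε_k`. -/
def Ya {N d K : ℕ} (A : Matrix (Fin d) (Fin d) ℝ) (wk : Fin K → Fin d → ℝ) (k : Fin K)
    (ω : Sample N d K) : Fin N → ℝ :=
  Xmat A ω *ᵥ wk k + ω.2.1 k

/-- The weighted least-squares estimator. -/
def wHat {N d K : ℕ} (A : Matrix (Fin d) (Fin d) ℝ) (wm : Fin d → ℝ)
    (wk : Fin K → Fin d → ℝ) (lam : Fin K → ℝ) (ω : Sample N d K) : Fin d → ℝ :=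
  (1 / (1 + ∑ k, lam k)) •
    (pinv (Xmat A ω) *ᵥ Ym A wm ω + ∑ k, lam k • (pinv (Xmat A ω) *ᵥ Ya A wk k ω))

/-- The expected estimator `w̄ = E_D[ŵ_D]` (componentwise expectation). -/
def wBar (N d K : ℕ) (A : Matrix (Fin d) (Fin d) ℝ) (wm : Fin d → ℝ)
    (wk : Fin K → Fin d → ℝ) (lam : Fin K → ℝ) (σm : ℝ) (σa : Fin K → ℝ) : Fin d → ℝ :=
  fun i => ∫ ω, wHat A wm wk lam ω i ∂(P N d K σm σa)

open scoped ENNReal NNReal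

instance (n : ℕ) (v : ℝ) : IsProbabilityMeasure (gaussianVec n v) := by
  unfold gaussianVec; infer_instance

lemma gv_one (n : ℕ) : gaussianVec n 1 = Measure.pi fun _ : Fin n => gaussianReal 0 1 := by
  simp [gaussianVec]

lemma coord_integrable (n : ℕ) (v : ℝ) (j : Fin n) :
    Integrable (fun z : Fin n → ℝ => z j) (gaussianVec n v) := by
  unfold gaussianVec
  exact integrable_eval (μ := fun _ : Fin n => gaussianReal 0 (Real.toNNReal v))
    (i := j) IsGaussian.integrable_id

lemma coord_integral (n : ℕ) (v : ℝ) (j : Fin n) :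
    ∫ z : Fin n → ℝ, z j ∂(gaussianVec n v) = 0 := by
  unfold gaussianVec
  rw [integral_eval (μ := fun _ : Fin n => gaussianReal 0 (Real.toNNReal v)) (i := j)]
  simp

lemma gv_gauss (n : ℕ) : HasGaussianLaw (fun z : Fin n → ℝ => z) (gaussianVec n 1) := by
  rw [gv_one]
  have h := iIndepFun_pi (μ := fun _ : Fin n => gaussianReal 0 1) (X := fun _ x => x)
    (fun i => aemeasurable_id)
  refine h.hasGaussianLaw (fun i => ?_)
  have := (measurePreserving_eval (fun _ : Fin n => gaussianReal 0 1) i).map_eq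
  refine ⟨?_⟩
  have h2 : (fun ω : Fin n → ℝ => ω i) = Function.eval i := rfl
  rw [h2, this]; infer_instance

/-- dot product functional -/
def dotL {n : ℕ} (u : Fin n → ℝ) : (Fin n → ℝ) →L[ℝ] ℝ :=
  LinearMap.toContinuousLinearMap
    { toFun := fun z => u ⬝ᵥ z, map_add' := by simp [dotProduct_add],
      map_smul' := by simp [dotProduct_smul] }

lemma dotL_apply {n : ℕ} (u z : Fin n → ℝ) : dotL u z = u ⬝ᵥ z := rfl

lemma dot_gauss {n : ℕ} (u : Fin n → ℝ) :
    HasGaussianLaw (fun z : Fin n → ℝ => u ⬝ᵥ z) (gaussianVec n 1) :=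
  (gv_gauss n).map_fun (dotL u)

lemma dot_mean {n : ℕ} (u : Fin n → ℝ) :
    ∫ z : Fin n → ℝ, u ⬝ᵥ z ∂(gaussianVec n 1) = 0 := by
  simp only [dotProduct]
  rw [integral_finsetSum _ (fun i _ => (coord_integrable n 1 i).const_mul _)]
  simp [integral_const_mul, coord_integral]

lemma dot_var {n : ℕ} (u : Fin n → ℝ) :
    Var[fun z : Fin n → ℝ => u ⬝ᵥ z; gaussianVec n 1] = u ⬝ᵥ u := by
  have : (fun z : Fin n → ℝ => u ⬝ᵥ z) = ∑ i, (fun z : Fin n → ℝ => u i * z i) := by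
    ext z; simp [dotProduct]
  rw [this, gv_one, variance_sum_pi (X := fun i x => u i * x)]
  · change ∑ i, Var[fun x ↦ _ * (id x); gaussianReal 0 1] = _
    simp_rw [variance_const_mul, variance_id_gaussianReal]
    simp [dotProduct, sq]
  · exact fun i ↦ IsGaussian.memLp_two_id.const_mul _

lemma dot_law {n : ℕ} (u : Fin n → ℝ) :
    (gaussianVec n 1).map (fun z : Fin n → ℝ => u ⬝ᵥ z) = gaussianReal 0 (u ⬝ᵥ u).toNNReal := by
  rw [(dot_gauss u).map_eq_gaussianReal, dot_mean, dot_var]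

lemma dot_sq {n : ℕ} (u : Fin n → ℝ) :
    ∫ z : Fin n → ℝ, (u ⬝ᵥ z) ^ 2 ∂(gaussianVec n 1) = u ⬝ᵥ u := by
  rw [← dot_var u, variance_of_integral_eq_zero (dot_gauss u).aemeasurable (dot_mean u)]

lemma dot_indep {n : ℕ} (u v : Fin n → ℝ) (huv : u ⬝ᵥ v = 0) :
    IndepFun (fun z : Fin n → ℝ => u ⬝ᵥ z) (fun z => v ⬝ᵥ z) (gaussianVec n 1) := by
  apply HasGaussianLaw.indepFun_of_covariance_eq_zero
  · exact (gv_gauss n).map_fun ((dotL u).prod (dotL v))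
  · have h := variance_add (dot_gauss u).memLp_two (dot_gauss v).memLp_two
    have h2 : ((fun z : Fin n → ℝ => u ⬝ᵥ z) + fun z => v ⬝ᵥ z) = fun z => (u + v) ⬝ᵥ z := by
      ext z; simp [add_dotProduct]
    rw [h2, dot_var, dot_var, dot_var] at h
    simp only [add_dotProduct, dotProduct_add, dotProduct_comm v u, huv] at h
    linarith

lemma dot_ne_zero {n : ℕ} (u : Fin n → ℝ) (hu : u ≠ 0) :
    ∀ᵐ z ∂(gaussianVec n 1), u ⬝ᵥ z ≠ 0 := by
  have hpos : 0 < u ⬝ᵥ u := by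
    have h0 : 0 ≤ u ⬝ᵥ u := by simpa using dotProduct_star_self_nonneg u
    refine lt_of_le_of_ne h0 (fun h => hu (dotProduct_self_eq_zero.1 h.symm))
  have : NullSingletonClass (gaussianReal 0 (u ⬝ᵥ u).toNNReal) :=
    nullSingletonClass_gaussianReal (by simpa using hpos)
  have h : ∀ᵐ x ∂((gaussianVec n 1).map (fun z : Fin n → ℝ => u ⬝ᵥ z)), x ≠ 0 := by
    rw [dot_law]
    exact Measure.ae_ne _ 0
  exact ae_of_ae_map (dot_gauss u).aemeasurable h

/-- `|x|^{-1/2}` in extended nonnegative reals -/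
def hinv (x : ℝ) : ℝ≥0∞ := ‖x‖ₑ ^ (-(1/2) : ℝ)

lemma hinv_meas : Measurable hinv := by unfold hinv; fun_prop

lemma hinv_finite : ∫⁻ x, hinv x ∂(gaussianReal 0 1) < ∞ := by
  have hint : Integrable (fun x : ℝ => |x| ^ (-(1/2) : ℝ) * Real.exp (-(1/2) * x ^ 2)) := by
    have h1 := integrableOn_rpow_mul_exp_neg_mul_sq (b := 1/2) (by norm_num)
      (s := -(1/2)) (by norm_num)
    have h2 : IntegrableOn (fun x : ℝ => |x| ^ (-(1/2) : ℝ) * Real.exp (-(1/2) * x ^ 2))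
        (Set.Ioi 0) := by
      refine h1.congr_fun (fun x hx => ?_) measurableSet_Ioi
      simp only [abs_of_pos (Set.mem_Ioi.1 hx)]
    rw [← integrableOn_univ, ← Set.Iio_union_Ici (a := (0:ℝ)), integrableOn_union,
      integrableOn_Ici_iff_integrableOn_Ioi]
    refine ⟨?_, h2⟩
    rw [← (Measure.measurePreserving_neg (volume : Measure ℝ)).integrableOn_comp_preimage
      (Homeomorph.neg ℝ).measurableEmbedding]
    simpa [Function.comp_def] using h2
  rw [gaussianReal_of_var_ne_zero _ (by norm_num),
    lintegral_withDensity_eq_lintegral_mul _ (by fun_prop) hinv_meas]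
  refine lt_of_le_of_lt ?_ hint.2
  refine lintegral_mono_ae ?_
  filter_upwards [Measure.ae_ne volume (0:ℝ)] with x hx
  have hx' : 0 < |x| := abs_pos.2 hx
  simp only [Pi.mul_apply, hinv, gaussianPDF]
  rw [Real.enorm_eq_ofReal_abs, ENNReal.ofReal_rpow_of_pos hx', ← ENNReal.ofReal_mul (gaussianPDFReal_nonneg _ _ _),
    Real.enorm_eq_ofReal_abs]
  apply ENNReal.ofReal_le_ofReal
  rw [abs_of_nonneg (mul_nonneg (Real.rpow_nonneg hx'.le _) (Real.exp_nonneg _)), mul_comm]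
  refine mul_le_mul_of_nonneg_left ?_ (Real.rpow_nonneg hx'.le _)
  rw [gaussianPDFReal]
  have h1 : (√(2 * Real.pi * (1:ℝ≥0)))⁻¹ ≤ 1 := by
    apply inv_le_one_of_one_le₀
    rw [Real.one_le_sqrt]
    have := Real.pi_gt_three
    norm_num; linarith
  have h2 : -(x - 0) ^ 2 / (2 * ((1:ℝ≥0):ℝ)) = -(1/2) * x ^ 2 := by norm_num; ring
  rw [h2]
  exact mul_le_of_le_one_left (Real.exp_nonneg _) h1

/-- the 2D bound -/
lemma hinv_pair {n : ℕ} (u v : Fin n → ℝ) (hu : u ⬝ᵥ u = 1) (hv : v ⬝ᵥ v = 1)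
    (huv : u ⬝ᵥ v = 0) :
    ∫⁻ z, hinv (u ⬝ᵥ z) * hinv (v ⬝ᵥ z) ∂(gaussianVec n 1) =
      (∫⁻ x, hinv x ∂(gaussianReal 0 1)) * ∫⁻ x, hinv x ∂(gaussianReal 0 1) := by
  have mu : ∀ w : Fin n → ℝ, Measurable (fun z : Fin n → ℝ => w ⬝ᵥ z) :=
    fun w => (dotL w).continuous.measurable
  have key : ∀ w : Fin n → ℝ, w ⬝ᵥ w = 1 → ∫⁻ z, hinv (w ⬝ᵥ z) ∂(gaussianVec n 1) =
      ∫⁻ x, hinv x ∂(gaussianReal 0 1) := by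
    intro w hw
    rw [← lintegral_map hinv_meas (mu w), dot_law, hw]; simp
  refine Eq.trans ?_ (congrArg₂ (· * ·) (key u hu) (key v hv))
  exact lintegral_mul_eq_lintegral_mul_lintegral_of_indepFun (hinv_meas.comp (mu u))
    (hinv_meas.comp (mu v)) ((dot_indep u v huv).comp hinv_meas hinv_meas)

lemma exists_pair {N d : ℕ} (hN : d + 1 < N) (Z : Fin N → Fin d → ℝ) (i : Fin d) :
    ∃ u v : Fin N → ℝ, u ⬝ᵥ u = 1 ∧ v ⬝ᵥ v = 1 ∧ u ⬝ᵥ v = 0 ∧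
      (∀ k, k ≠ i → u ⬝ᵥ (fun r => Z r k) = 0) ∧ (∀ k, k ≠ i → v ⬝ᵥ (fun r => Z r k) = 0) := by
  classical
  let c : {k : Fin d // k ≠ i} → EuclideanSpace ℝ (Fin N) := fun k => WithLp.toLp 2 (fun r => Z r k)
  let W := Submodule.span ℝ (Set.range c)
  have h1 : Module.finrank ℝ W ≤ d := by
    refine (finrank_range_le_card c).trans ?_
    refine (Fintype.card_subtype_le _).trans ?_
    simp
  have h2 := W.finrank_add_finrank_orthogonal
  rw [finrank_euclideanSpace_fin] at h2
  have h3 : 2 ≤ Module.finrank ℝ Wᗮ := by omega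
  let b := stdOrthonormalBasis ℝ Wᗮ
  let u : EuclideanSpace ℝ (Fin N) := b ⟨0, by omega⟩
  let v : EuclideanSpace ℝ (Fin N) := b ⟨1, by omega⟩
  have ip : ∀ x y : EuclideanSpace ℝ (Fin N), x.ofLp ⬝ᵥ y.ofLp = inner ℝ x y := by
    intro x y; rw [EuclideanSpace.inner_eq_star_dotProduct]; simp [dotProduct_comm]
  have hb := orthonormal_iff_ite.1 b.orthonormal
  have ho : ∀ (x : Wᗮ) (k : Fin d), k ≠ i →
      (x : EuclideanSpace ℝ (Fin N)).ofLp ⬝ᵥ (fun r => Z r k) = 0 := by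
    intro x k hk
    have := ip x (c ⟨k, hk⟩)
    rw [show (c ⟨k, hk⟩).ofLp = fun r => Z r k from rfl] at this
    rw [this]
    exact (Submodule.mem_orthogonal' _ _).1 x.2 _ (Submodule.subset_span ⟨_, rfl⟩)
  refine ⟨u.ofLp, v.ofLp, ?_, ?_, ?_, ho _, ho _⟩
  · rw [ip]
    have := hb ⟨0, by omega⟩ ⟨0, by omega⟩
    rw [if_pos rfl] at this
    exact this
  · rw [ip]
    have := hb ⟨1, by omega⟩ ⟨1, by omega⟩
    rw [if_pos rfl] at this
    exact this
  · rw [ip]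
    have := hb ⟨0, by omega⟩ ⟨1, by omega⟩
    rw [if_neg (by simp [Fin.ext_iff])] at this
    exact this

lemma pinv_mul {N d : ℕ} (Z : Matrix (Fin N) (Fin d) ℝ) (h : IsUnit (Zᵀ * Z).det) :
    pinv Z * Z = 1 := by
  rw [pinv, Matrix.mul_assoc, Matrix.nonsing_inv_mul _ h]

lemma pinv_zero {N d : ℕ} (Z : Matrix (Fin N) (Fin d) ℝ) (h : ¬ IsUnit (Zᵀ * Z).det) :
    pinv Z = 0 := by
  rw [pinv, Matrix.nonsing_inv_apply_not_isUnit _ h, Matrix.zero_mul]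

lemma bessel2 {n : ℕ} (u v p : Fin n → ℝ) (hu : u ⬝ᵥ u = 1) (hv : v ⬝ᵥ v = 1)
    (huv : u ⬝ᵥ v = 0) : (u ⬝ᵥ p) ^ 2 + (v ⬝ᵥ p) ^ 2 ≤ p ⬝ᵥ p := by
  have h : 0 ≤ (p - (u ⬝ᵥ p) • u - (v ⬝ᵥ p) • v) ⬝ᵥ (p - (u ⬝ᵥ p) • u - (v ⬝ᵥ p) • v) := by
    simpa using dotProduct_star_self_nonneg (p - (u ⬝ᵥ p) • u - (v ⬝ᵥ p) • v)
  simp only [sub_dotProduct, dotProduct_sub, smul_dotProduct, dotProduct_smul, smul_eq_mul,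
    hu, hv, huv, dotProduct_comm v u, dotProduct_comm p u, dotProduct_comm p v] at h
  nlinarith

lemma pinv_bound {N d : ℕ} (Z : Matrix (Fin N) (Fin d) ℝ) (i : Fin d) (j : Fin N)
    (u v : Fin N → ℝ) (hu : u ⬝ᵥ u = 1) (hv : v ⬝ᵥ v = 1) (huv : u ⬝ᵥ v = 0)
    (hu' : ∀ k, k ≠ i → u ⬝ᵥ (fun r => Z r k) = 0) (hv' : ∀ k, k ≠ i → v ⬝ᵥ (fun r => Z r k) = 0) :
    ‖pinv Z i j‖ₑ ≤ hinv (u ⬝ᵥ fun r => Z r i) * hinv (v ⬝ᵥ fun r => Z r i) := by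
  by_cases h : IsUnit (Zᵀ * Z).det
  swap
  · rw [pinv_zero Z h]; simp
  set c : Fin d → ℝ := fun k => (Zᵀ * Z)⁻¹ i k with hc
  set p : Fin N → ℝ := fun r => pinv Z i r with hp
  set a := u ⬝ᵥ fun r => Z r i with ha
  set b := v ⬝ᵥ fun r => Z r i with hb
  have hpc : p = ∑ k, c k • (fun r => Z r k) := by
    ext r; simp [hp, hc, pinv, Matrix.mul_apply]
  have hpz : ∀ k, p ⬝ᵥ (fun r => Z r k) = if k = i then 1 else 0 := by
    intro k
    have := congrFun (congrFun (pinv_mul Z h) i) k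
    rw [Matrix.mul_apply, Matrix.one_apply] at this
    simp only [eq_comm (a := k)]
    exact this
  have hdot : ∀ w : Fin N → ℝ, (w ⬝ᵥ p) = ∑ k, c k * (w ⬝ᵥ fun r => Z r k) := by
    intro w
    conv_lhs => rw [hpc]
    rw [dotProduct_sum]; simp only [dotProduct_smul, smul_eq_mul]
  have hpp : p ⬝ᵥ p = c i := by
    rw [hdot]; simp [hpz]
  have hup : u ⬝ᵥ p = c i * a := by
    rw [hdot, Finset.sum_eq_single i]
    · intro k _ hk; rw [hu' k hk, mul_zero]
    · simp
  have hvp : v ⬝ᵥ p = c i * b := by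
    rw [hdot, Finset.sum_eq_single i]
    · intro k _ hk; rw [hv' k hk, mul_zero]
    · simp
  have hB := bessel2 u v p hu hv huv
  rw [hup, hvp, hpp] at hB
  have hpj : (p j) ^ 2 ≤ c i := by
    rw [← hpp, dotProduct, sq]
    exact Finset.single_le_sum (f := fun r => p r * p r) (fun r _ => mul_self_nonneg _)
      (Finset.mem_univ j)
  change ‖p j‖ₑ ≤ _
  by_cases ha0 : a = 0
  · rw [hinv, ha0]
    simp only [enorm_zero]
    rw [ENNReal.zero_rpow_of_neg (by norm_num), ENNReal.top_mul]
    · exact le_top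
    · rw [hinv]; simp [ENNReal.rpow_eq_zero_iff]
  by_cases hb0 : b = 0
  · rw [hinv, hinv, hb0]
    simp only [enorm_zero]
    rw [ENNReal.zero_rpow_of_neg (by norm_num), ENNReal.mul_top]
    · exact le_top
    · simp [ENNReal.rpow_eq_zero_iff]
  have ha1 : 0 < |a| := abs_pos.2 ha0
  have hb1 : 0 < |b| := abs_pos.2 hb0
  rw [hinv, hinv, Real.enorm_eq_ofReal_abs, Real.enorm_eq_ofReal_abs, Real.enorm_eq_ofReal_abs,
    ENNReal.ofReal_rpow_of_pos ha1, ENNReal.ofReal_rpow_of_pos hb1,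
    ← ENNReal.ofReal_mul (Real.rpow_nonneg ha1.le _)]
  apply ENNReal.ofReal_le_ofReal
  rw [← Real.mul_rpow ha1.le hb1.le, Real.rpow_neg (by positivity), ← Real.sqrt_eq_rpow,
    ← Real.sqrt_inv]
  apply Real.abs_le_sqrt
  refine hpj.trans ?_
  have hab : 0 < |a| * |b| := by positivity
  rcases le_or_gt (c i) 0 with hc0 | hc0
  · exact hc0.trans (inv_nonneg.2 hab.le)
  rw [le_inv_comm₀ hc0 hab, le_inv_comm₀ hab hc0, ← one_div, le_div_iff₀ hab]
  have h1 : |a| * |b| ≤ a ^ 2 + b ^ 2 := by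
    nlinarith [sq_nonneg (|a| - |b|), sq_abs a, sq_abs b, sq_nonneg a, sq_nonneg b]
  have h2 : c i * (c i * (a ^ 2 + b ^ 2)) ≤ c i * 1 := by nlinarith
  have h3 := le_of_mul_le_mul_left h2 hc0
  nlinarith [mul_le_mul_of_nonneg_left h1 hc0.le]

/-- the law of the standard Gaussian matrix -/
abbrev μZ (N d : ℕ) : Measure (Fin N → Fin d → ℝ) := Measure.pi fun _ : Fin N => gaussianVec d 1

lemma row_update {d : ℕ} (i : Fin d) :
    MeasurePreserving (fun q : (Fin d → ℝ) × ℝ => Function.update q.1 i q.2)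
      ((gaussianVec d 1).prod (gaussianReal 0 1)) (gaussianVec d 1) := by
  have hm : Measurable (fun q : (Fin d → ℝ) × ℝ => Function.update q.1 i q.2) := by
    refine measurable_pi_lambda _ (fun k => ?_)
    by_cases hk : k = i
    · subst hk; simpa using measurable_snd
    · simp only [Function.update_of_ne hk]; fun_prop
  refine ⟨hm, ?_⟩
  rw [gv_one]
  symm
  refine Measure.pi_eq (fun s hs => ?_)
  rw [Measure.map_apply hm (MeasurableSet.univ_pi hs)]
  have : (fun q : (Fin d → ℝ) × ℝ => Function.update q.1 i q.2) ⁻¹' (Set.univ.pi s) =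
      (Set.univ.pi (Function.update s i Set.univ)) ×ˢ (s i) := by
    ext q
    simp only [Set.mem_preimage, Set.mem_pi, Set.mem_univ, forall_true_left, Set.mem_prod]
    constructor
    · intro h
      refine ⟨fun k => ?_, by simpa using h i⟩
      by_cases hk : k = i
      · subst hk; simp
      · simpa [hk] using h k
    · rintro ⟨h1, h2⟩ k
      by_cases hk : k = i
      · subst hk; simpa using h2
      · simpa [hk] using h1 k
  rw [this, Measure.prod_prod, Measure.pi_pi]
  rw [← Finset.mul_prod_erase Finset.univ (fun k => gaussianReal 0 1 (s k)) (Finset.mem_univ i),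
    ← Finset.mul_prod_erase Finset.univ _ (Finset.mem_univ i)]
  simp only [Function.update_self, measure_univ, one_mul]
  rw [mul_comm]
  congr 1
  refine Finset.prod_congr rfl (fun k hk => ?_)
  rw [Function.update_of_ne (Finset.ne_of_mem_erase hk)]

/-- replace column `i` -/
def colUpd {N d : ℕ} (i : Fin d) (q : (Fin N → Fin d → ℝ) × (Fin N → ℝ)) : Fin N → Fin d → ℝ :=
  fun r => Function.update (q.1 r) i (q.2 r)

lemma colUpd_mp {N d : ℕ} (i : Fin d) :
    MeasurePreserving (colUpd (N := N) i) ((μZ N d).prod (gaussianVec N 1)) (μZ N d) := by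
  have h1 := measurePreserving_pi (ι := Fin N) (fun _ => (gaussianVec d 1).prod (gaussianReal 0 1))
    (fun _ => gaussianVec d 1) (fun _ => row_update i)
  have h2 := measurePreserving_arrowProdEquivProdArrow (Fin d → ℝ) ℝ (Fin N)
    (fun _ => gaussianVec d 1) (fun _ => gaussianReal 0 1)
  have h3 := h1.comp h2.symm
  rw [← gv_one] at h3
  exact h3

lemma pinv_entry_meas {N d : ℕ} (i : Fin d) (j : Fin N) :
    Measurable (fun Z : Fin N → Fin d → ℝ => pinv (Matrix.of Z) i j) := by
  have hc : Continuous (fun Z : Fin N → Fin d → ℝ => (Matrix.of Z : Matrix (Fin N) (Fin d) ℝ)) :=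
    continuous_id
  have hg : Continuous (fun Z : Fin N → Fin d → ℝ =>
      ((Matrix.of Z)ᵀ * Matrix.of Z : Matrix (Fin d) (Fin d) ℝ)) :=
    hc.matrix_transpose.matrix_mul hc
  simp only [pinv, Matrix.mul_apply, Matrix.inv_def, Ring.inverse_eq_inv', Matrix.smul_apply,
    smul_eq_mul]
  refine Finset.measurable_sum _ (fun k _ => ?_)
  refine Measurable.mul (Measurable.mul ?_ ?_) ?_
  · exact hg.matrix_det.measurable.inv
  · exact (hg.matrix_adjugate.matrix_elem i k).measurable
  · exact (hc.matrix_transpose.matrix_elem k j).measurable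

lemma pinv_integrable {N d : ℕ} (hN : d + 1 < N) (i : Fin d) (j : Fin N) :
    Integrable (fun Z : Fin N → Fin d → ℝ => pinv (Matrix.of Z) i j) (μZ N d) := by
  have hm := pinv_entry_meas (N := N) i j
  refine ⟨hm.aestronglyMeasurable, ?_⟩
  rw [hasFiniteIntegral_iff_enorm, ← (colUpd_mp (N := N) i).lintegral_comp hm.enorm]
  refine lt_of_eq_of_lt
    (lintegral_prod _ ((hm.enorm.comp (colUpd_mp i).measurable).aemeasurable)) ?_
  have hC := hinv_finite
  refine lt_of_le_of_lt (lintegral_mono (g := fun _ => (∫⁻ x, hinv x ∂(gaussianReal 0 1)) *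
    ∫⁻ x, hinv x ∂(gaussianReal 0 1)) (fun Z => ?_)) ?_
  · obtain ⟨u, v, hu, hv, huv, hu', hv'⟩ := exists_pair hN Z i
    rw [← hinv_pair u v hu hv huv]
    refine lintegral_mono (fun z => ?_)
    have hk : ∀ k, k ≠ i → (fun r => Matrix.of (colUpd i (Z, z)) r k) = fun r => Z r k := by
      intro k hk; ext r; simp [colUpd, hk]
    have hi : (fun r => Matrix.of (colUpd i (Z, z)) r i) = z := by
      ext r; simp [colUpd]
    have := pinv_bound (Matrix.of (colUpd i (Z, z))) i j u v hu hv huv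
      (fun k h => by rw [hk k h]; exact hu' k h) (fun k h => by rw [hk k h]; exact hv' k h)
    rw [hi] at this
    exact this
  · rw [lintegral_const, measure_univ, mul_one]
    exact ENNReal.mul_lt_top hC hC

/-- mixed square matrix -/
def mixM {N d : ℕ} (h : d ≤ N) (s : Finset (Fin d)) (Z : Fin N → Fin d → ℝ) :
    Matrix (Fin d) (Fin d) ℝ :=
  fun r k => if k ∈ s then Z (Fin.castLE h r) k else (1 : Matrix (Fin d) (Fin d) ℝ) r k

lemma mixM_cont {N d : ℕ} (h : d ≤ N) (s : Finset (Fin d)) : Continuous (mixM h s) := by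
  refine continuous_matrix (fun r k => ?_)
  unfold mixM
  split_ifs <;> fun_prop

lemma mixM_ae {N d : ℕ} (h : d ≤ N) (s : Finset (Fin d)) :
    ∀ᵐ Z ∂(μZ N d), (mixM h s Z).det ≠ 0 := by
  classical
  induction s using Finset.induction_on with
  | empty =>
    refine Filter.Eventually.of_forall (fun Z => ?_)
    have : mixM h ∅ Z = 1 := by ext r k; simp [mixM]
    rw [this]; simp
  | insert i s hi ih =>
    have hms : MeasurableSet {Z : Fin N → Fin d → ℝ | (mixM h (insert i s) Z).det ≠ 0} :=
      ((mixM_cont h _).matrix_det.measurable (measurableSet_singleton 0)).compl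
    rw [← (colUpd_mp (N := N) i).map_eq, ae_map_iff (colUpd_mp i).measurable.aemeasurable hms]
    refine (Measure.ae_prod_iff_ae_ae ((colUpd_mp i).measurable hms)).2 ?_
    filter_upwards [ih] with Z hZ
    have hupd : ∀ z, mixM h (insert i s) (colUpd i (Z, z)) =
        (mixM h s Z).updateCol i (fun r => z (Fin.castLE h r)) := by
      intro z
      ext r k
      by_cases hk : k = i
      · subst hk; simp [mixM, colUpd]
      · simp [mixM, colUpd, hk, Matrix.updateCol_apply]
    let L : (Fin N → ℝ) →ₗ[ℝ] ℝ :=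
      (LinearMap.proj i) ∘ₗ (Matrix.cramer (mixM h s Z)) ∘ₗ
        (LinearMap.funLeft ℝ ℝ (Fin.castLE h))
    have hL : ∀ z, (mixM h (insert i s) (colUpd i (Z, z))).det = L z := by
      intro z
      rw [hupd]
      simp only [L, LinearMap.comp_apply, LinearMap.proj_apply, Matrix.cramer_apply]
      rfl
    let c : Fin N → ℝ := fun j => L (Pi.single j 1)
    have hLc : ∀ z, L z = c ⬝ᵥ z := by
      intro z
      rw [LinearMap.pi_apply_eq_sum_univ L z]
      simp only [dotProduct, c, smul_eq_mul]
      refine Finset.sum_congr rfl (fun j _ => ?_)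
      rw [mul_comm]
      congr 2
      ext k; simp [Pi.single_apply, eq_comm]
    have hc : c ≠ 0 := by
      intro hc0
      obtain ⟨z, hz⟩ : ∃ z : Fin N → ℝ, ∀ r, z (Fin.castLE h r) = mixM h s Z r i := by
        refine ⟨fun j => if hj : (j : ℕ) < d then mixM h s Z ⟨j, hj⟩ i else 0, fun r => ?_⟩
        simp
      have h1 : (mixM h (insert i s) (colUpd i (Z, z))).det = (mixM h s Z).det := by
        rw [hupd]
        congr 1
        ext r k
        by_cases hk : k = i
        · subst hk; simp [hz]
        · simp [hk]
      apply hZ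
      rw [← h1, hL, hLc, hc0, zero_dotProduct]
    filter_upwards [dot_ne_zero c hc] with z hz
    rw [hL, hLc]; exact hz

lemma gram_ae {N d : ℕ} (h : d ≤ N) :
    ∀ᵐ Z ∂(μZ N d), IsUnit ((Matrix.of Z)ᵀ * Matrix.of Z : Matrix (Fin d) (Fin d) ℝ).det := by
  filter_upwards [mixM_ae h Finset.univ] with Z hZ
  rw [isUnit_iff_ne_zero]
  intro h0
  obtain ⟨v, hv, hv0⟩ := Matrix.exists_mulVec_eq_zero_iff.2 h0
  have h1 : (Matrix.of Z) *ᵥ v = 0 := by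
    have : ((Matrix.of Z) *ᵥ v) ⬝ᵥ ((Matrix.of Z) *ᵥ v) = 0 := by
      rw [Matrix.dotProduct_mulVec, Matrix.vecMul_mulVec, ← Matrix.mulVec_transpose]
      simp only [Matrix.transpose_mul, Matrix.transpose_transpose]
      rw [hv0, zero_dotProduct]
    exact dotProduct_self_eq_zero.1 this
  apply hZ
  apply Matrix.exists_mulVec_eq_zero_iff.1
  refine ⟨v, hv, ?_⟩
  ext r
  have := congrFun h1 (Fin.castLE h r)
  simpa [Matrix.mulVec, dotProduct, mixM] using this


lemma pinv_X {N d : ℕ} (Z : Matrix (Fin N) (Fin d) ℝ) (A : Matrix (Fin d) (Fin d) ℝ)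
    (hA : IsUnit A.det) : pinv (Z * Aᵀ) = (Aᵀ)⁻¹ * pinv Z := by
  have h1 : (Z * Aᵀ)ᵀ * (Z * Aᵀ) = A * ((Zᵀ * Z) * Aᵀ) := by
    simp only [Matrix.transpose_mul, Matrix.transpose_transpose, Matrix.mul_assoc]
  rw [pinv, h1, Matrix.mul_inv_rev, Matrix.mul_inv_rev, Matrix.transpose_mul,
    Matrix.transpose_transpose, pinv]
  rw [Matrix.mul_assoc, ← Matrix.mul_assoc A⁻¹, Matrix.nonsing_inv_mul _ hA, Matrix.one_mul,
    Matrix.mul_assoc]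

lemma task_mean {N d : ℕ} (hN : d + 1 < N) (A : Matrix (Fin d) (Fin d) ℝ) (hA : IsUnit A.det)
    {T : Type*} [MeasurableSpace T] (ν : Measure T) [IsProbabilityMeasure ν]
    (e : T → Fin N → ℝ) (he : ∀ j, Integrable (fun τ => e τ j) ν)
    (he0 : ∀ j, ∫ τ, e τ j ∂ν = 0) (w : Fin d → ℝ) (i : Fin d) :
    Integrable (fun ω : (Fin N → Fin d → ℝ) × T =>
      (pinv (Matrix.of ω.1 * Aᵀ) *ᵥ ((Matrix.of ω.1 * Aᵀ) *ᵥ w + e ω.2)) i) ((μZ N d).prod ν) ∧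
    ∫ ω : (Fin N → Fin d → ℝ) × T,
      (pinv (Matrix.of ω.1 * Aᵀ) *ᵥ ((Matrix.of ω.1 * Aᵀ) *ᵥ w + e ω.2)) i ∂((μZ N d).prod ν)
      = w i := by
  have hpi : ∀ j, Integrable (fun Z : Fin N → Fin d → ℝ => pinv (Matrix.of Z * Aᵀ) i j)
      (μZ N d) := by
    intro j
    simp only [pinv_X _ A hA, Matrix.mul_apply]
    exact integrable_finsetSum _ (fun k _ => (pinv_integrable hN k j).const_mul _)
  have hterm : ∀ j, Integrable (fun ω : (Fin N → Fin d → ℝ) × T =>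
      pinv (Matrix.of ω.1 * Aᵀ) i j * e ω.2 j) ((μZ N d).prod ν) :=
    fun j => (hpi j).mul_prod (he j)
  have hterm0 : ∀ j, ∫ ω : (Fin N → Fin d → ℝ) × T,
      pinv (Matrix.of ω.1 * Aᵀ) i j * e ω.2 j ∂((μZ N d).prod ν) = 0 := by
    intro j
    refine (integral_prod_mul (fun Z : Fin N → Fin d → ℝ => pinv (Matrix.of Z * Aᵀ) i j)
      (fun τ => e τ j)).trans ?_
    rw [he0, mul_zero]
  have hsum := integrable_finsetSum Finset.univ (fun j _ => hterm j)
  have hae : (fun ω : (Fin N → Fin d → ℝ) × T =>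
      (pinv (Matrix.of ω.1 * Aᵀ) *ᵥ ((Matrix.of ω.1 * Aᵀ) *ᵥ w + e ω.2)) i) =ᵐ[(μZ N d).prod ν]
      fun ω => w i + ∑ j, pinv (Matrix.of ω.1 * Aᵀ) i j * e ω.2 j := by
    have hg := Measure.quasiMeasurePreserving_fst (μ := μZ N d) (ν := ν) |>.ae
      (gram_ae (N := N) (d := d) (by omega))
    filter_upwards [hg] with ω hω
    have hinv1 : pinv (Matrix.of ω.1 * Aᵀ) * (Matrix.of ω.1 * Aᵀ) = 1 := by
      apply pinv_mul
      have h1 : (Matrix.of ω.1 * Aᵀ)ᵀ * (Matrix.of ω.1 * Aᵀ) =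
          A * (((Matrix.of ω.1)ᵀ * Matrix.of ω.1) * Aᵀ) := by
        simp only [Matrix.transpose_mul, Matrix.transpose_transpose, Matrix.mul_assoc]
      rw [h1, Matrix.det_mul, Matrix.det_mul, Matrix.det_transpose]
      exact hA.mul (hω.mul hA)
    rw [Matrix.mulVec_add, Matrix.mulVec_mulVec, hinv1, Matrix.one_mulVec]
    rfl
  constructor
  · exact ((integrable_const _).add hsum).congr hae.symm
  · rw [integral_congr_ae hae, integral_add (integrable_const _) hsum,
      integral_finsetSum _ (fun j _ => hterm j)]
    simp [hterm0]

/-- the mean of the weighted least-squares estimator is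
`w̄ = (1/(1+Λ))(w*_m + ∑_k λ_k w*_k)`, and consequently (when `Λ > 0`) the bias term is
`E_x[(xᵀ(w̄ − w*_m))²] = (Λ/(1+Λ))²‖Σ_x^{1/2}(w*_aux − w*_m)‖²`. -/
theorem mean_estimator_and_bias
    (N d K : ℕ) (hN : d + 1 < N)
    (Sigx : Matrix (Fin d) (Fin d) ℝ) (hSig : Sigx.PosDef)
    (A : Matrix (Fin d) (Fin d) ℝ) (hA : A * Aᵀ = Sigx)
    (wm : Fin d → ℝ) (wk : Fin K → Fin d → ℝ)
    (σm : ℝ) (hσm : 0 < σm) (σa : Fin K → ℝ) (hσa : ∀ k, 0 < σa k)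
    (lam : Fin K → ℝ) (hlam : ∀ k, 0 ≤ lam k) :
    wBar N d K A wm wk lam σm σa =
        (1 / (1 + ∑ k, lam k)) • (wm + ∑ k, lam k • wk k) ∧
      (0 < ∑ k, lam k →
        (∫ g, ((A *ᵥ g) ⬝ᵥ (wBar N d K A wm wk lam σm σa - wm)) ^ 2 ∂(gaussianVec d 1)) =
          ((∑ k, lam k) / (1 + ∑ k, lam k)) ^ 2 *
            quadForm Sigx ((1 / ∑ k, lam k) • (∑ k, lam k • wk k) - wm)) := by
  have hdet : IsUnit A.det := by
    have h1 := hSig.det_pos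
    rw [← hA, Matrix.det_mul, Matrix.det_transpose] at h1
    rw [isUnit_iff_ne_zero]
    intro h0
    rw [h0] at h1
    simp at h1
  have hL0 : 0 ≤ ∑ k, lam k := Finset.sum_nonneg (fun k _ => hlam k)
  have hmean : wBar N d K A wm wk lam σm σa =
      (1 / (1 + ∑ k, lam k)) • (wm + ∑ k, lam k • wk k) := by
    ext i
    let ν := (Measure.pi fun k : Fin K => gaussianVec N (σa k ^ 2)).prod (gaussianVec N (σm ^ 2))
    have hm := task_mean hN A hdet ν (fun τ => τ.2)
      (fun j => (coord_integrable N (σm ^ 2) j).comp_snd _)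
      (fun j => by
        have h := integral_fun_snd (μ := Measure.pi fun k : Fin K => gaussianVec N (σa k ^ 2))
          (ν := gaussianVec N (σm ^ 2)) (fun z : Fin N → ℝ => z j)
        rw [coord_integral] at h
        simpa using h) wm i
    have hk := fun k => task_mean hN A hdet ν (fun τ => τ.1 k)
      (fun j => Integrable.comp_fst (f := fun z : Fin K → Fin N → ℝ => z k j)
        (integrable_comp_eval (μ := fun k : Fin K => gaussianVec N (σa k ^ 2)) (i := k)
          (coord_integrable N (σa k ^ 2) j)) _)
      (fun j => by
        have h := integral_fun_fst (μ := Measure.pi fun k : Fin K => gaussianVec N (σa k ^ 2))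
          (ν := gaussianVec N (σm ^ 2)) (fun z : Fin K → Fin N → ℝ => z k j)
        rw [integral_comp_eval (μ := fun k : Fin K => gaussianVec N (σa k ^ 2)) (i := k)
          (coord_integrable N (σa k ^ 2) j).aestronglyMeasurable, coord_integral] at h
        simpa using h) (wk k) i
    have hint : ∀ ω : Sample N d K, wHat A wm wk lam ω i = (1 / (1 + ∑ k, lam k)) *
        ((pinv (Matrix.of ω.1 * Aᵀ) *ᵥ ((Matrix.of ω.1 * Aᵀ) *ᵥ wm + ω.2.2)) i +
          ∑ k, lam k *
            (pinv (Matrix.of ω.1 * Aᵀ) *ᵥ ((Matrix.of ω.1 * Aᵀ) *ᵥ wk k + ω.2.1 k)) i) := by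
      intro ω
      simp [wHat, Ym, Ya, Xmat]
    have hP : P N d K σm σa = (μZ N d).prod ν := rfl
    simp only [wBar, hint, hP]
    rw [integral_const_mul, integral_add hm.1
      (integrable_finsetSum _ (fun k _ => (hk k).1.const_mul _)), hm.2,
      integral_finsetSum _ (fun k _ => (hk k).1.const_mul _)]
    simp only [integral_const_mul, (hk _).2]
    simp
  refine ⟨hmean, fun hpos => ?_⟩
  set L := ∑ k, lam k with hL
  set v := (1 / L) • (∑ k, lam k • wk k) - wm with hv
  have hdiff : wBar N d K A wm wk lam σm σa - wm = (L / (1 + L)) • v := by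
    rw [hmean, hv]
    ext i
    simp only [Pi.sub_apply, Pi.smul_apply, Pi.add_apply, smul_eq_mul]
    have : 1 + L ≠ 0 := by positivity
    field_simp
    ring
  have hdot : ∀ g : Fin d → ℝ, (A *ᵥ g) ⬝ᵥ (wBar N d K A wm wk lam σm σa - wm) =
      (L / (1 + L)) * ((Aᵀ *ᵥ v) ⬝ᵥ g) := by
    intro g
    rw [hdiff, dotProduct_smul, smul_eq_mul, dotProduct_comm, Matrix.dotProduct_mulVec,
      Matrix.mulVec_transpose]
  simp only [hdot, mul_pow]
  rw [integral_const_mul, dot_sq, quadForm, ← hA, ← Matrix.mulVec_mulVec,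
    Matrix.dotProduct_mulVec v A, Matrix.mulVec_transpose]

end Stmt16
end
end
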